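/- Let H be a 3-uniform hypergraph with no linear cycle, |V(H)| ≥ 6, and let s ≥ −1 be an integer. If every vertex of H has degree at least |V(H)| + s, then H has an induced subhypergraph H_0 on |V(H)| − 4 vertices in which every vertex has degree (within H_0) at least |V(H_0)| + s + 2. -/

import Mathlib

/-- A linear cycle of length `k ≥ 3` in a 3-uniform hypergraph with edge set `E`:
an alternating cyclic sequence of distinct vertices `v i` and distinct hyperedges `h i`
with `h i ∩ h (i+1) = {v (i+1)}` and non-consecutive hyperedges disjoint. -/
def IsLinearCycle {V : Type*} [DecidableEq V] (E : Finset (Finset V)) (k : ℕ)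
    (v : ZMod k → V) (h : ZMod k → Finset V) : Prop :=
  3 ≤ k ∧ Function.Injective v ∧ Function.Injective h ∧
    (∀ i, h i ∈ E) ∧ (∀ i, h i ∩ h (i + 1) = {v (i + 1)}) ∧
    (∀ i j, i ≠ j → i + 1 ≠ j → j + 1 ≠ i → h i ∩ h j = ∅)

/-- `E` contains a linear cycle. -/
def HasLinearCycle {V : Type*} [DecidableEq V] (E : Finset (Finset V)) : Prop :=
  ∃ (k : ℕ) (v : ZMod k → V) (h : ZMod k → Finset V), IsLinearCycle E k v h

/-- The degree of a vertex: the number of hyperedges containing it. -/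
def hDegree {V : Type*} [DecidableEq V] (E : Finset (Finset V)) (v : V) : ℕ :=
  (E.filter (fun e => v ∈ e)).card

/-- The support of a vertex `v` in a hyperedge `h`: the pairs of `h` that form a
hyperedge together with `v`. -/
def hSupport {V : Type*} [DecidableEq V] (E : Finset (Finset V)) (h : Finset V) (v : V) :
    Finset (Finset V) :=
  (h.powersetCard 2).filter (fun p => insert v p ∈ E)

/-- A pair of vertices is thick if at least two hyperedges contain it. -/
def ThickPair {V : Type*} [DecidableEq V] (E : Finset (Finset V)) (a b : V) : Prop :=
  2 ≤ (E.filter (fun e => a ∈ e ∧ b ∈ e)).card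

/-- A hyperedge is thick if each of its pairs is contained in at least two hyperedges. -/
def ThickEdge {V : Type*} [DecidableEq V] (E : Finset (Finset V)) (h : Finset V) : Prop :=
  ∀ p ∈ h.powersetCard 2, 2 ≤ (E.filter (fun e => p ⊆ e)).card

/-- `v ∉ h` is strongly associated to the hyperedge `h` if at least two of the 3-sets
formed by `v` and a pair of `h` are hyperedges. -/
def StronglyAssoc {V : Type*} [DecidableEq V] (E : Finset (Finset V)) (h : Finset V) (v : V) :
    Prop :=
  v ∉ h ∧ 2 ≤ (hSupport E h v).card

/-- A linear path of length `k` (given by its sequence of hyperedges): consecutive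
hyperedges meet in exactly one vertex, non-consecutive ones are disjoint. -/
def IsLinearPath {V : Type*} [DecidableEq V] (E : Finset (Finset V)) (k : ℕ)
    (h : Fin k → Finset V) : Prop :=
  Function.Injective h ∧ (∀ i, h i ∈ E) ∧
    (∀ i j : Fin k, (i : ℕ) + 1 = (j : ℕ) → (h i ∩ h j).card = 1) ∧
    (∀ i j : Fin k, (i : ℕ) + 2 ≤ (j : ℕ) → h i ∩ h j = ∅)

/-- A linear tree with vertex set `S` and edge set `T`: built from a single vertex by
repeatedly adding hyperedges meeting the current vertex set in exactly one vertex. -/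
inductive IsLinearTree {V : Type*} [DecidableEq V] : Finset V → Finset (Finset V) → Prop
  | single (v : V) : IsLinearTree {v} ∅
  | extend {S : Finset V} {T : Finset (Finset V)} (e : Finset V) :
      IsLinearTree S T → e.card = 3 → (e ∩ S).card = 1 → IsLinearTree (S ∪ e) (insert e T)

namespace HG
variable {V : Type*} [DecidableEq V]

/-- linear path given by a function on ℕ -/
structure LP (E : Finset (Finset V)) (h : ℕ → Finset V) (k : ℕ) : Prop where
  mem : ∀ i, i < k → h i ∈ E
  adj : ∀ i, i + 1 < k → (h i ∩ h (i+1)).card = 1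
  dis : ∀ i j, i + 2 ≤ j → j < k → ∀ x, x ∈ h i → x ∉ h j

/-- prepend an edge -/
def cons (e : Finset V) (h : ℕ → Finset V) : ℕ → Finset V
  | 0 => e
  | i+1 => h i

theorem LP.cons {E : Finset (Finset V)} {h : ℕ → Finset V} {k : ℕ} (H : LP E h k)
    {e : Finset V} (he : e ∈ E) (h0 : 0 < k → (e ∩ h 0).card = 1)
    (h1 : ∀ i, 1 ≤ i → i < k → ∀ x, x ∈ e → x ∉ h i) : LP E (cons e h) (k+1) := by
  refine ⟨?_, ?_, ?_⟩
  · rintro (_ | i) hi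
    · exact he
    · exact H.mem i (by omega)
  · rintro (_ | i) hi
    · exact h0 (by omega)
    · exact H.adj i (by omega)
  · rintro (_ | i) (_ | j) hij hj
    · omega
    · exact h1 j (by omega) (by omega)
    · omega
    · exact H.dis i j (by omega) (by omega)

theorem LP.shift {E : Finset (Finset V)} {h : ℕ → Finset V} {k : ℕ} (H : LP E h k) (m : ℕ) :
    LP E (fun i => h (i + m)) (k - m) := by
  refine ⟨fun i hi => H.mem _ (by omega), fun i hi => ?_, fun i j hij hj => H.dis _ _ (by omega) (by omega)⟩
  have := H.adj (i+m) (by omega)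
  rwa [show i + m + 1 = i + 1 + m by omega] at this

theorem LP.rev {E : Finset (Finset V)} {h : ℕ → Finset V} {k : ℕ} (H : LP E h k) :
    LP E (fun i => h (k - 1 - i)) k := by
  refine ⟨fun i hi => H.mem _ (by omega), fun i hi => ?_, fun i j hij hj x hx hx' =>
    H.dis _ _ (by omega) (by omega) x hx' hx⟩
  have := H.adj (k-1-(i+1)) (by omega)
  rw [show k-1-(i+1)+1 = k-1-i by omega] at this
  rwa [Finset.inter_comm]

theorem cycle_of_fun {E : Finset (Finset V)} (h3 : ∀ e ∈ E, e.card = 3) (k : ℕ) (hk : 3 ≤ k)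
    (g : ℕ → Finset V) (hg : ∀ i < k, g i ∈ E)
    (hadj : ∀ i, i + 1 < k → (g i ∩ g (i+1)).card = 1)
    (hlast : (g (k-1) ∩ g 0).card = 1)
    (hdis : ∀ i j, i + 2 ≤ j → j < k → ¬ (i = 0 ∧ j = k - 1) → ∀ x, x ∈ g i → x ∉ g j)
    (h012 : k = 3 → ∀ x, x ∈ g 0 → x ∈ g 1 → x ∉ g 2) : HasLinearCycle E := by
  haveI : NeZero k := ⟨by omega⟩
  haveI : Fact (1 < k) := ⟨by omega⟩
  let h : ZMod k → Finset V := fun i => g i.val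
  have hval : ∀ i : ZMod k, i.val < k := fun i => ZMod.val_lt i
  have hsucc : ∀ i : ZMod k, (i.val + 1 < k ∧ (i+1).val = i.val + 1) ∨ (i.val = k - 1 ∧ (i+1).val = 0) := by
    intro i
    have h1 : (i+1).val = (i.val + 1) % k := by
      rw [ZMod.val_add, ZMod.val_one]
    have := hval i
    rcases Nat.lt_or_ge (i.val+1) k with h | h
    · left; exact ⟨h, by rw [h1, Nat.mod_eq_of_lt h]⟩
    · right
      have : i.val + 1 = k := by omega
      exact ⟨by omega, by rw [h1, this, Nat.mod_self]⟩
  have hA : ∀ i, (h i ∩ h (i+1)).card = 1 := by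
    intro i
    rcases hsucc i with ⟨a, b⟩ | ⟨a, b⟩
    · simp only [h, b]; exact hadj _ a
    · simp only [h, b, a]; exact hlast
  have hne : ∀ i j : ZMod k, i ≠ j → i.val ≠ j.val := fun i j hij hv => hij (ZMod.val_injective k hv)
  have hD0 : ∀ i j : ZMod k, i.val < j.val → i + 1 ≠ j → j + 1 ≠ i → h i ∩ h j = ∅ := by
    intro i j hij h1 h2
    have a1 := hsucc i
    have a2 := hsucc j
    have a3 := hne _ _ h1
    have a4 := hne _ _ h2
    have a5 := hval j
    rw [← Finset.disjoint_iff_inter_eq_empty, Finset.disjoint_left]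
    intro x hx
    exact hdis i.val j.val (by omega) (by omega) (by omega) x hx
  have hD : ∀ i j, i ≠ j → i + 1 ≠ j → j + 1 ≠ i → h i ∩ h j = ∅ := by
    intro i j h1 h2 h4
    rcases lt_or_gt_of_ne (hne _ _ h1) with hh | hh
    · exact hD0 i j hh h2 h4
    · rw [Finset.inter_comm]; exact hD0 j i hh h4 h2
  have hsne : ∀ i : ZMod k, i + 1 + 1 ≠ i := by
    intro i hi
    have a1 := hsucc i
    have a2 := hsucc (i+1)
    rw [hi] at a2
    omega
  have hsne1 : ∀ i : ZMod k, i + 1 ≠ i := by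
    intro i hi
    have a1 := hsucc i
    rw [hi] at a1
    omega
  have hT : ∀ i x, x ∈ h i → x ∈ h (i+1) → x ∉ h (i+1+1) := by
    intro i x h1 h2 h4
    by_cases hk3 : k = 3
    · have a1 := hsucc i
      have a2 := hsucc (i+1)
      have hh := h012 hk3 x
      have b0 := hval i
      have : (i.val = 0 ∧ (i+1).val = 1 ∧ (i+1+1).val = 2) ∨ (i.val = 1 ∧ (i+1).val = 2 ∧ (i+1+1).val = 0) ∨ (i.val = 2 ∧ (i+1).val = 0 ∧ (i+1+1).val = 1) := by omega
      simp only [h] at h1 h2 h4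
      rcases this with ⟨b1, b2, b3⟩ | ⟨b1, b2, b3⟩ | ⟨b1, b2, b3⟩ <;> rw [b1] at h1 <;> rw [b2] at h2 <;> rw [b3] at h4 <;> tauto
    · have := hD i (i+1+1) (hsne i).symm (by intro h'; exact hsne1 _ h'.symm) (by
        intro hh
        have a1 := hsucc i
        have a2 := hsucc (i+1)
        have a3 := hsucc (i+1+1)
        rw [hh] at a3
        omega)
      have : x ∈ h i ∩ h (i+1+1) := Finset.mem_inter.2 ⟨h1, h4⟩
      simp_all
  have hv : ∀ i, ∃ x, h (i - 1) ∩ h i = {x} := by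
    intro i
    have := hA (i-1)
    rw [sub_add_cancel] at this
    exact Finset.card_eq_one.1 this
  choose v hv using hv
  have hvm : ∀ i, v i ∈ h (i-1) ∧ v i ∈ h i := by
    intro i
    have : v i ∈ h (i-1) ∩ h i := by rw [hv]; simp
    simpa using this
  have hsub : ∀ i : ZMod k, i - 1 + 1 = i := fun i => sub_add_cancel _ _
  refine ⟨k, v, h, hk, ?_, ?_, fun i => hg _ (hval i), ?_, hD⟩
  · intro i j hij
    by_contra hne'
    by_cases c1 : i + 1 = j
    · subst c1
      have e1 := hT (i-1) (v i) (hvm i).1 (by rw [hsub]; exact (hvm i).2)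
      rw [hsub, hij] at e1
      exact e1 (hvm _).2
    by_cases c2 : j + 1 = i
    · subst c2
      have e1 := hT (j-1) (v j) (hvm j).1 (by rw [hsub]; exact (hvm j).2)
      rw [hsub, ← hij] at e1
      exact e1 (hvm _).2
    have e := hD i j hne' c1 c2
    have : v i ∈ h i ∩ h j := Finset.mem_inter.2 ⟨(hvm i).2, hij ▸ (hvm j).2⟩
    simp_all
  · intro i j hij
    by_contra hne'
    have c3 : (h i).card = 3 := h3 _ (hg _ (hval i))
    by_cases c1 : i + 1 = j
    · subst c1
      have := hA i
      rw [← hij, Finset.inter_self] at this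
      omega
    by_cases c2 : j + 1 = i
    · subst c2
      have := hA j
      rw [hij, Finset.inter_self] at this
      rw [hij] at c3
      omega
    have e := hD i j hne' c1 c2
    rw [← hij, Finset.inter_self] at e
    rw [e] at c3
    simp at c3
  · intro i
    have := hv (i+1)
    rwa [add_sub_cancel_right] at this

theorem LP.close {E : Finset (Finset V)} (h3 : ∀ e ∈ E, e.card = 3) {h : ℕ → Finset V} {k : ℕ}
    (H : LP E h k) {e : Finset V} (he : e ∈ E) (j : ℕ) (hj1 : 1 ≤ j) (hjk : j < k)
    (c0 : (e ∩ h 0).card = 1) (cj : (e ∩ h j).card = 1)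
    (hm : ∀ i, 0 < i → i < j → ∀ x, x ∈ e → x ∉ h i)
    (h0j : ∀ x, x ∈ e → x ∈ h 0 → x ∉ h j) : HasLinearCycle E := by
  refine cycle_of_fun h3 (j+2) (by omega) (fun i => if i = j + 1 then e else h i) ?_ ?_ ?_ ?_ ?_
  · intro i hi
    split_ifs
    · exact he
    · exact H.mem i (by omega)
  · intro i hi
    split_ifs with a b b
    · omega
    · omega
    · obtain rfl : i = j := by omega
      rwa [Finset.inter_comm]
    · exact H.adj i (by omega)
  · rw [if_pos (by omega), if_neg (by omega)]
    exact c0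
  · intro i i' hi hi' hn x
    rw [if_neg (by omega)]
    split_ifs with a
    · intro h1 h2
      exact hm i (by omega) (by omega) x h2 h1
    · exact H.dis i i' hi (by omega) x
  · intro hj x
    obtain rfl : j = 1 := by omega
    simp only [show (0:ℕ) ≠ 1 + 1 by omega, show (1:ℕ) ≠ 1+1 by omega, if_false, show (2:ℕ) = 1 + 1 by omega, if_true]
    intro a b c
    exact h0j x c a b

/-- an edge meeting the first edge in one vertex and the rest in exactly one other vertex -/
theorem LP.close' {E : Finset (Finset V)} (h3 : ∀ e ∈ E, e.card = 3) {h : ℕ → Finset V} {k : ℕ}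
    (H : LP E h k) {e : Finset V} (he : e ∈ E) (c0 : (e ∩ h 0).card = 1) (y : V) (m : ℕ)
    (hm1 : 1 ≤ m) (hmk : m < k) (hy : y ∈ e) (hym : y ∈ h m) (hy0 : y ∉ h 0)
    (hu : ∀ z ∈ e, ∀ i, 1 ≤ i → i < k → z ∈ h i → z = y) : HasLinearCycle E := by
  classical
  have hex : ∃ j, 1 ≤ j ∧ j < k ∧ y ∈ h j := ⟨m, hm1, hmk, hym⟩
  obtain ⟨a1, a2, a3⟩ := Nat.find_spec hex
  have hmin := fun j (hj : j < Nat.find hex) => Nat.find_min hex hj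
  generalize Nat.find hex = j at *
  refine H.close h3 he j a1 a2 c0 ?_ ?_ ?_
  · rw [Finset.card_eq_one]
    refine ⟨y, ?_⟩
    ext z
    simp only [Finset.mem_inter, Finset.mem_singleton]
    constructor
    · rintro ⟨b1, b2⟩; exact hu z b1 j a1 a2 b2
    · rintro rfl; exact ⟨hy, a3⟩
  · intro i hi hij x hx hxi
    have := hu x hx i hi (by omega) hxi
    subst this
    exact hmin i hij ⟨hi, by omega, hxi⟩
  · intro x hx hx0 hxj
    have := hu x hx j a1 a2 hxj
    subst this
    exact hy0 hx0

theorem tri {E : Finset (Finset V)} (h3 : ∀ e ∈ E, e.card = 3) (hcyc : ¬ HasLinearCycle E)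
    (x u y v z w : V) (hnd : [x,u,y,v,z,w].Nodup)
    (h1 : ({x,u,y} : Finset V) ∈ E) (h2 : ({y,v,z} : Finset V) ∈ E) (h4 : ({z,w,x} : Finset V) ∈ E) : False := by
  apply hcyc
  simp only [List.nodup_cons, List.mem_cons, List.not_mem_nil, or_false, not_or, List.nodup_nil, not_false_eq_true, and_true] at hnd
  have hP : LP E (cons {x,u,y} (fun _ => {y,v,z})) 2 := by
    have h0 : LP E (fun _ => ({y,v,z} : Finset V)) 1 := ⟨fun _ _ => h2, fun i hi => by omega, fun i j hi => by omega⟩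
    refine h0.cons h1 (fun _ => ?_) (fun i => by omega)
    rw [Finset.card_eq_one]; refine ⟨y, ?_⟩; ext t; simp only [Finset.mem_inter, Finset.mem_insert, Finset.mem_singleton]; grind
  refine hP.close h3 h4 1 le_rfl (by omega) ?_ ?_ (fun i => by omega) ?_
  · rw [Finset.card_eq_one]; refine ⟨x, ?_⟩; ext t; simp only [cons, Finset.mem_inter, Finset.mem_insert, Finset.mem_singleton]; grind
  · rw [Finset.card_eq_one]; refine ⟨z, ?_⟩; ext t; simp only [cons, Finset.mem_inter, Finset.mem_insert, Finset.mem_singleton]; grind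
  · intro t; simp only [cons, Finset.mem_insert, Finset.mem_singleton]; grind
end HG
namespace HG
variable {V : Type*} [DecidableEq V]

theorem ne3 {E : Finset (Finset V)} (h3 : ∀ e ∈ E, e.card = 3) {x y z : V}
    (h : ({x,y,z} : Finset V) ∈ E) : x ≠ y ∧ x ≠ z ∧ y ≠ z := by
  have := h3 _ h
  refine ⟨?_, ?_, ?_⟩
  · rintro rfl
    have := Finset.card_le_two (a := x) (b := z)
    simp_all
  · rintro rfl
    have : ({x,y,x} : Finset V) = {x,y} := by ext; simp; tauto
    have := Finset.card_le_two (a := x) (b := y)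
    simp_all
  · rintro rfl
    have := Finset.card_le_two (a := x) (b := y)
    simp_all

theorem meq {E : Finset (Finset V)} {s t : Finset V} (h : s ∈ E) (hst : s = t) : t ∈ E := hst ▸ h

variable [Fintype V]

/-- third vertices of edges through the pair -/
def A (E : Finset (Finset V)) (a b : V) : Finset V :=
  Finset.univ.filter (fun y => y ≠ a ∧ y ≠ b ∧ ({a,b,y} : Finset V) ∈ E)

/-- link pairs of `a` avoiding `b` -/
def L (E : Finset (Finset V)) (a b : V) : Finset (Finset V) :=
  Finset.univ.filter (fun p => p.card = 2 ∧ a ∉ p ∧ b ∉ p ∧ insert a p ∈ E)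

theorem mem_A {E : Finset (Finset V)} {a b y : V} :
    y ∈ A E a b ↔ y ≠ a ∧ y ≠ b ∧ ({a,b,y} : Finset V) ∈ E := by simp [A]

theorem mem_L {E : Finset (Finset V)} {a b : V} {p : Finset V} :
    p ∈ L E a b ↔ p.card = 2 ∧ a ∉ p ∧ b ∉ p ∧ insert a p ∈ E := by simp [L]

theorem A_comm (E : Finset (Finset V)) (a b : V) : A E a b = A E b a := by
  ext y
  rw [mem_A, mem_A, Finset.insert_comm]
  tauto

theorem mem_L_pair {E : Finset (Finset V)} (h3 : ∀ e ∈ E, e.card = 3) {a b x y : V}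
    (h : ({a,x,y} : Finset V) ∈ E) (hx : x ≠ b) (hy : y ≠ b) : ({x,y} : Finset V) ∈ L E a b := by
  obtain ⟨h1, h2, h4⟩ := ne3 h3 h
  rw [mem_L]
  refine ⟨Finset.card_pair h4, ?_, ?_, h⟩ <;> simp <;> tauto

theorem mem_L_erase {E : Finset (Finset V)} (h3 : ∀ e ∈ E, e.card = 3) {a b : V} {e : Finset V}
    (h : e ∈ E) (ha : a ∈ e) (hb : b ∉ e) : e.erase a ∈ L E a b := by
  rw [mem_L]
  refine ⟨?_, by simp, by simp [hb], by rwa [Finset.insert_erase ha]⟩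
  rw [Finset.card_erase_of_mem ha, h3 e h]

theorem edge_eq {E : Finset (Finset V)} (h3 : ∀ e ∈ E, e.card = 3) {e : Finset V} (h : e ∈ E) {a b c : V}
    (ha : a ∈ e) (hb : b ∈ e) (hc : c ∈ e) (hab : a ≠ b) (hac : a ≠ c) (hbc : b ≠ c) : e = {a,b,c} := by
  symm
  apply Finset.eq_of_subset_of_card_le
  · intro x; simp; grind
  · rw [h3 e h, Finset.card_eq_three.2 ⟨a,b,c,hab,hac,hbc,rfl⟩]

theorem deg_le {E : Finset (Finset V)} (h3 : ∀ e ∈ E, e.card = 3) {a b : V} (hab : a ≠ b) :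
    hDegree E a ≤ (A E a b).card + (L E a b).card := by
  unfold hDegree
  have : E.filter (fun e => a ∈ e) ⊆ (A E a b).image (fun y => ({a,b,y} : Finset V)) ∪ (L E a b).image (fun p => insert a p) := by
    intro e he
    rw [Finset.mem_filter] at he
    obtain ⟨he, hae⟩ := he
    rw [Finset.mem_union, Finset.mem_image, Finset.mem_image]
    by_cases hb : b ∈ e
    · left
      have h1 : ((e.erase a).erase b).card = 1 := by
        rw [Finset.card_erase_of_mem (by simp [hb, hab.symm]), Finset.card_erase_of_mem hae, h3 e he]
      obtain ⟨y, hy⟩ := Finset.card_eq_one.1 h1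
      have hy' : y ∈ (e.erase a).erase b := by rw [hy]; simp
      simp only [Finset.mem_erase] at hy'
      have := edge_eq h3 he hae hb hy'.2.2 hab (Ne.symm hy'.2.1) (Ne.symm hy'.1)
      exact ⟨y, mem_A.2 ⟨hy'.2.1, hy'.1, this ▸ he⟩, this.symm⟩
    · right
      exact ⟨_, mem_L_erase h3 he hae hb, Finset.insert_erase hae⟩
  calc _ ≤ _ := Finset.card_le_card this
    _ ≤ _ := Finset.card_union_le _ _
    _ ≤ _ := Nat.add_le_add Finset.card_image_le Finset.card_image_le

theorem A_sub (E : Finset (Finset V)) (a b : V) : A E a b ⊆ Finset.univ \ {a,b} := by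
  intro y hy
  rw [mem_A] at hy
  simp; tauto

theorem card_univ_sub {a b : V} (hab : a ≠ b) : (Finset.univ \ {a,b} : Finset V).card = Fintype.card V - 2 := by
  rw [Finset.card_sdiff_of_subset (Finset.subset_univ _), Finset.card_univ, Finset.card_pair hab]

theorem A_card {E : Finset (Finset V)} {a b : V} (hab : a ≠ b) : (A E a b).card ≤ Fintype.card V - 2 := by
  rw [← card_univ_sub hab]
  exact Finset.card_le_card (A_sub E a b)

theorem exists_notin (s : Finset V) (h : s.card < Fintype.card V) : ∃ x, x ∉ s := by
  by_contra hc
  push Not at hc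
  have : s = Finset.univ := by ext; simp [hc]
  rw [this, Finset.card_univ] at h
  omega

theorem XT {E : Finset (Finset V)} (h3 : ∀ e ∈ E, e.card = 3) (hcyc : ¬ HasLinearCycle E)
    {a b r : V} {s p q : Finset V} (hs : s.card ≤ 3) (ha : a ∉ s) (hb : b ∉ s) (hr : r ∉ s)
    (hp : p ⊆ s) (hq : q ⊆ s) (hpq : p ≠ q) (hpL : p ∈ L E a b) (hqL : q ∈ L E b a)
    (habr : ({a,b,r} : Finset V) ∈ E) : False := by
  rw [mem_L] at hpL hqL
  have h1 := Finset.card_union_add_card_inter p q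
  have h2 := Finset.card_le_card (Finset.union_subset hp hq)
  have h4 : 0 < (p ∩ q).card := by omega
  obtain ⟨x, hx⟩ := Finset.card_pos.1 h4
  rw [Finset.mem_inter] at hx
  have e1 : (p.erase x).card = 1 := by rw [Finset.card_erase_of_mem hx.1]; omega
  have e2 : (q.erase x).card = 1 := by rw [Finset.card_erase_of_mem hx.2]; omega
  obtain ⟨y, hy⟩ := Finset.card_eq_one.1 e1
  obtain ⟨z, hz⟩ := Finset.card_eq_one.1 e2
  have p1 : p = {x, y} := by rw [← hy, Finset.insert_erase hx.1]
  have q1 : q = {x, z} := by rw [← hz, Finset.insert_erase hx.2]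
  have yz : y ≠ z := by rintro rfl; exact hpq (by rw [p1, q1])
  obtain ⟨n1, n2, n3⟩ := ne3 h3 habr
  subst p1 q1
  obtain ⟨m1, m2, m3⟩ := ne3 h3 hpL.2.2.2
  obtain ⟨k1, k2, k3⟩ := ne3 h3 hqL.2.2.2
  have t1 : x ∈ s := hp (by simp)
  have t2 : y ∈ s := hp (by simp)
  have t3 : z ∈ s := hq (by simp)
  refine tri h3 hcyc a y x z b r ?_ (meq hpL.2.2.2 ?_) (meq hqL.2.2.2 ?_) (meq habr ?_)
  · simp only [List.nodup_cons, List.mem_cons, List.not_mem_nil, or_false, not_or, List.nodup_nil, not_false_eq_true, and_true]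
    grind
  all_goals (clear * -; ext t; simp only [Finset.mem_insert, Finset.mem_singleton]; tauto)


set_option maxHeartbeats 1000000 in
theorem partner {E : Finset (Finset V)} (h3 : ∀ e ∈ E, e.card = 3) (hcyc : ¬ HasLinearCycle E)
    (hn : 6 ≤ Fintype.card V) {a b c d : V} (hab : ∀ y, y ≠ a → y ≠ b → ({a,b,y} : Finset V) ∈ E)
    (hL : L E a b = {{c,d}}) : L E c d ⊆ {{a,b}} := by
  have hcd : ({c,d} : Finset V) ∈ L E a b := by rw [hL]; simp
  rw [mem_L] at hcd
  obtain ⟨g1, g2, g3, g4⟩ := hcd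
  obtain ⟨n1, n2, n3⟩ := ne3 h3 g4
  simp only [Finset.mem_insert, Finset.mem_singleton, not_or] at g2 g3
  intro p hp
  rw [mem_L] at hp
  obtain ⟨p1, p2, p3, p4⟩ := hp
  obtain ⟨u, v, huv, rfl⟩ := Finset.card_eq_two.1 p1
  simp only [Finset.mem_insert, Finset.mem_singleton, not_or] at p2 p3 ⊢
  have hne : a ≠ b := by
    obtain ⟨y, hy⟩ := exists_notin ({a,b} : Finset V) (lt_of_le_of_lt Finset.card_le_two (by omega))
    simp only [Finset.mem_insert, Finset.mem_singleton, not_or] at hy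
    exact (ne3 h3 (hab y hy.1 hy.2)).1
  have key : ∀ v, v ≠ c → v ≠ d → v ≠ a → ({c,a,v} : Finset V) ∈ E → v = b := by
    intro v v1 v2 v3 hE
    by_contra hvb
    have : ({c,v} : Finset V) ∈ L E a b := mem_L_pair h3 (meq hE (by clear * -; ext; simp; tauto)) (Ne.symm g3.1) hvb
    rw [hL, Finset.mem_singleton] at this
    have : v ∈ ({c,d} : Finset V) := by rw [← this]; simp
    simp at this; tauto
  have key2 : ∀ v, v ≠ c → v ≠ d → v ≠ a → v ≠ b → ({c,b,v} : Finset V) ∈ E → False := by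
    intro v v1 v2 v3 v4 hE
    obtain ⟨u, hu⟩ := exists_notin ({a,b,c,d,v} : Finset V) (lt_of_le_of_lt Finset.card_le_five (by omega))
    simp only [Finset.mem_insert, Finset.mem_singleton, not_or] at hu
    refine tri h3 hcyc a d c v b u ?_ (meq g4 ?_) (meq hE ?_) (meq (hab u hu.1 hu.2.1) ?_)
    · simp only [List.nodup_cons, List.mem_cons, List.not_mem_nil, or_false, not_or, List.nodup_nil, not_false_eq_true, and_true]
      grind
    all_goals (clear * -; ext t; simp only [Finset.mem_insert, Finset.mem_singleton]; tauto)
  by_cases ua : u = a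
  · subst ua
    rw [key v (by tauto) (by tauto) (by tauto) p4]
  by_cases va : v = a
  · subst va
    rw [key u (by tauto) (by tauto) (by tauto) (meq p4 (by clear * -; ext; simp; tauto)), Finset.pair_comm]
  by_cases ub : u = b
  · subst ub
    exact (key2 v (by tauto) (by tauto) (by tauto) (by tauto) p4).elim
  by_cases vb : v = b
  · subst vb
    exact (key2 u (by tauto) (by tauto) (by tauto) (by tauto) (meq p4 (by clear * -; ext; simp; tauto))).elim
  exfalso
  refine tri h3 hcyc a d c v u b ?_ (meq g4 ?_) (meq p4 ?_) (meq (hab u ua ub) ?_)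
  · simp only [List.nodup_cons, List.mem_cons, List.not_mem_nil, or_false, not_or, List.nodup_nil, not_false_eq_true, and_true]
    grind
  all_goals (clear * -; ext t; simp only [Finset.mem_insert, Finset.mem_singleton]; tauto)

theorem A_full {E : Finset (Finset V)} (h3 : ∀ e ∈ E, e.card = 3) (hn : 6 ≤ Fintype.card V)
    {a b : V} (hab : a ≠ b) (hd : Fintype.card V ≤ hDegree E a + 1) (hL : (L E a b).card ≤ 1) :
    (∀ y, y ≠ a → y ≠ b → ({a,b,y} : Finset V) ∈ E) ∧ (L E a b).card = 1 := by
  have h1 := deg_le h3 hab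
  have h2 := A_card (E := E) hab
  have h4 : A E a b = Finset.univ \ {a,b} := by
    apply Finset.eq_of_subset_of_card_le (A_sub E a b)
    rw [card_univ_sub hab]; omega
  refine ⟨?_, by omega⟩
  intro y ya yb
  have : y ∈ A E a b := by rw [h4]; simp; tauto
  exact (mem_A.1 this).2.2

set_option maxHeartbeats 1000000 in
theorem good_pair {E : Finset (Finset V)} (h3 : ∀ e ∈ E, e.card = 3) (hcyc : ¬ HasLinearCycle E)
    (hn : 6 ≤ Fintype.card V) (hd : ∀ w, Fintype.card V ≤ hDegree E w + 1)
    {a b : V} (hab : a ≠ b) (hLa : (L E a b).card ≤ 1) (hLb : (L E b a).card ≤ 1) :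
    ∃ K : Finset V, K.card = 4 ∧ ∀ w, w ∉ K → ∃ e1 e2 : Finset V,
      ∀ e ∈ E, w ∈ e → (∃ x ∈ e, x ∈ K) → e = e1 ∨ e = e2 := by
  obtain ⟨f1, l1⟩ := A_full h3 hn hab (hd a) hLa
  obtain ⟨f2, l2⟩ := A_full h3 hn hab.symm (hd b) hLb
  obtain ⟨p, hp⟩ := Finset.card_eq_one.1 l1
  obtain ⟨q, hq⟩ := Finset.card_eq_one.1 l2
  have hp' : p ∈ L E a b := by rw [hp]; simp
  have hq' : q ∈ L E b a := by rw [hq]; simp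
  rw [mem_L] at hp' hq'
  obtain ⟨c, d, hcd, rfl⟩ := Finset.card_eq_two.1 hp'.1
  have hc := partner h3 hcyc hn f1 hp
  have hd' := partner h3 hcyc hn f1 (c := d) (d := c) (by rw [hp, Finset.pair_comm])
  obtain ⟨f3, -⟩ := A_full h3 hn hcd (hd c) ((Finset.card_le_card hc).trans (by simp))
  obtain ⟨g1, g2, g3, g4⟩ := hp'
  simp only [Finset.mem_insert, Finset.mem_singleton, not_or] at g2 g3
  obtain ⟨k1, k2, k3, k4⟩ := hq'
  obtain ⟨u, v, huv, rfl⟩ := Finset.card_eq_two.1 k1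
  simp only [Finset.mem_insert, Finset.mem_singleton, not_or] at k2 k3
  have hqp : ({u,v} : Finset V) = {c,d} := by
    have gen : ∀ c d, c ≠ a → c ≠ b → d ≠ a → d ≠ b → L E c d ⊆ {{a,b}} → c ∈ ({u,v} : Finset V) → d ∈ ({u,v} : Finset V) := by
      intro c d c1 c2 d1 d2 hc hcu
      clear * - h3 c1 c2 d1 d2 hc hcu hab k2 k3 k4
      by_contra hdu
      have := hc (mem_L_erase h3 k4 (by simp at hcu ⊢; tauto : c ∈ _) (by simp at hdu ⊢; tauto : d ∉ _))
      have h5 : a ∈ (insert b {u,v} : Finset V).erase c := by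
        rw [Finset.mem_singleton.1 this]; simp
      simp at h5; tauto
    have gc := gen c d (Ne.symm g2.1) (Ne.symm g3.1) (Ne.symm g2.2) (Ne.symm g3.2) hc
    have gd := gen d c (Ne.symm g2.2) (Ne.symm g3.2) (Ne.symm g2.1) (Ne.symm g3.1) hd'
    by_cases hcu : c ∈ ({u,v} : Finset V)
    · have hdu := gc hcu
      simp only [Finset.mem_insert, Finset.mem_singleton] at hcu hdu
      ext t; simp only [Finset.mem_insert, Finset.mem_singleton]; grind
    · have hdu : d ∉ ({u,v} : Finset V) := fun h => hcu (gd h)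
      simp only [Finset.mem_insert, Finset.mem_singleton, not_or] at hcu hdu
      exfalso
      refine tri h3 hcyc c d u v b a ?_ (f3 u (by tauto) (by tauto)) (meq k4 ?_) (meq (f1 c (by tauto) (by tauto)) ?_)
      · simp only [List.nodup_cons, List.mem_cons, List.not_mem_nil, or_false, not_or, List.nodup_nil, not_false_eq_true, and_true]
        grind
      all_goals (clear * -; ext t; simp only [Finset.mem_insert, Finset.mem_singleton]; tauto)
  rw [hqp] at hq
  refine ⟨{a,b,c,d}, ?_, ?_⟩
  · rw [Finset.card_insert_of_notMem, Finset.card_insert_of_notMem, Finset.card_pair hcd]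
    · simp; tauto
    · simp; tauto
  · intro w hw
    simp only [Finset.mem_insert, Finset.mem_singleton, not_or] at hw
    refine ⟨{a,b,w}, {c,d,w}, ?_⟩
    have gen : ∀ a b c d, w ≠ a → w ≠ c → w ≠ d → L E a b ⊆ {{c,d}} → ∀ e ∈ E, w ∈ e → a ∈ e → b ∈ e := by
      intro a b c d w1 w2 w3 hl e he hwe hae
      clear * - h3 w1 w2 w3 hl he hwe hae
      by_contra hbe
      have h1 := hl (mem_L_erase h3 he hae hbe)
      have : w ∈ e.erase a := by simp; tauto
      rw [Finset.mem_singleton.1 h1] at this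
      simp at this; tauto
    have ga := gen a b c d hw.1 hw.2.2.1 hw.2.2.2 (by rw [hp])
    have gb := gen b a c d hw.2.1 hw.2.2.1 hw.2.2.2 (by rw [hq])
    have gc := gen c d a b hw.2.2.1 hw.1 hw.2.1 hc
    have gd := gen d c a b hw.2.2.2 hw.1 hw.2.1 hd'
    rintro e he hwe ⟨x, hxe, hxK⟩
    have ga := ga e he hwe
    have gb := gb e he hwe
    have gc := gc e he hwe
    have gd := gd e he hwe
    simp only [Finset.mem_insert, Finset.mem_singleton] at hxK
    by_cases hae : a ∈ e
    · left
      exact edge_eq h3 he hae (ga hae) hwe hab (Ne.symm hw.1) (Ne.symm hw.2.1)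
    · right
      have hce : c ∈ e := by
        rcases hxK with rfl | rfl | rfl | rfl
        · exact absurd hxe hae
        · exact absurd (gb hxe) hae
        · exact hxe
        · exact gd hxe
      exact edge_eq h3 he hce (gc hce) hwe hcd (Ne.symm hw.2.2.1) (Ne.symm hw.2.2.2)
end HG
namespace HG
variable {V : Type*} [DecidableEq V]

/-- vertex set of a path -/
def VS (h : ℕ → Finset V) (k : ℕ) : Finset V := (Finset.range k).biUnion h

theorem mem_VS {h : ℕ → Finset V} {k : ℕ} {x : V} : x ∈ VS h k ↔ ∃ i < k, x ∈ h i := by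
  simp [VS]

theorem VS_card {E : Finset (Finset V)} (h3 : ∀ e ∈ E, e.card = 3) {h : ℕ → Finset V} :
    ∀ {k : ℕ}, LP E h (k+1) → (VS h (k+1)).card = 2 * (k+1) + 1 := by
  intro k
  induction k with
  | zero =>
    intro H
    have : VS h 1 = h 0 := by simp [VS]
    rw [show 0 + 1 = 1 from rfl, this, h3 _ (H.mem 0 (by omega))]
  | succ k ih =>
    intro H
    have H' : LP E h (k+1) := ⟨fun i hi => H.mem i (by omega), fun i hi => H.adj i (by omega), fun i j hi hj => H.dis i j hi (by omega)⟩
    have e1 : VS h (k+1+1) = VS h (k+1) ∪ h (k+1) := by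
      ext x
      rw [Finset.mem_union, mem_VS, mem_VS]
      constructor
      · rintro ⟨i, hi, hx⟩
        by_cases hh : i < k + 1
        · exact Or.inl ⟨i, hh, hx⟩
        · obtain rfl : i = k + 1 := by omega
          exact Or.inr hx
      · rintro (⟨i, hi, hx⟩ | hx)
        · exact ⟨i, by omega, hx⟩
        · exact ⟨k+1, by omega, hx⟩
    have e2 : VS h (k+1) ∩ h (k+1) = h k ∩ h (k+1) := by
      ext x
      rw [Finset.mem_inter, Finset.mem_inter, mem_VS]
      constructor
      · rintro ⟨⟨i, hi, hx⟩, hx'⟩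
        by_cases hh : i < k
        · exact absurd hx' (H.dis i (k+1) (by omega) (by omega) x hx)
        · obtain rfl : i = k := by omega
          exact ⟨hx, hx'⟩
      · rintro ⟨hx, hx'⟩
        exact ⟨⟨k, by omega, hx⟩, hx'⟩
    have e3 := Finset.card_union_add_card_inter (VS h (k+1)) (h (k+1))
    rw [e2, ← e1, ih H', h3 _ (H.mem (k+1) (by omega)), H.adj k (by omega)] at e3
    omega

/-- the end of a longest linear path -/
structure Cfg (E : Finset (Finset V)) (h : ℕ → Finset V) (k : ℕ) (a b c d e : V) : Prop where
  lp : LP E h k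
  mx : ∀ h' k', LP E h' k' → k' ≤ k
  k2 : 2 ≤ k
  h0 : h 0 = {a,b,c}
  h1 : h 1 = {c,d,e}
  he : 2 < k → e ∈ h 2

theorem Cfg.swap {E : Finset (Finset V)} {h : ℕ → Finset V} {k : ℕ} {a b c d e : V}
    (C : Cfg E h k a b c d e) : Cfg E h k b a c d e :=
  ⟨C.lp, C.mx, C.k2, by rw [C.h0, Finset.insert_comm], C.h1, C.he⟩

theorem exists_pair_of_card_three {s : Finset V} (hs : s.card = 3) {c : V} (hc : c ∈ s) :
    ∃ a b, s = {a,b,c} ∧ s = {c,a,b} := by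
  have : (s.erase c).card = 2 := by rw [Finset.card_erase_of_mem hc, hs]
  obtain ⟨a, b, -, hab⟩ := Finset.card_eq_two.1 this
  refine ⟨a, b, ?_, ?_⟩
  · rw [← Finset.insert_erase hc, hab]; ext; simp; tauto
  · rw [← Finset.insert_erase hc, hab]

theorem Cfg.exists {E : Finset (Finset V)} (h3 : ∀ e ∈ E, e.card = 3) {h : ℕ → Finset V} {k : ℕ}
    (lp : LP E h k) (mx : ∀ h' k', LP E h' k' → k' ≤ k) (k2 : 2 ≤ k) :
    ∃ a b c d e, Cfg E h k a b c d e := by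
  obtain ⟨c, hc⟩ := Finset.card_eq_one.1 (lp.adj 0 (by omega))
  have hc' : c ∈ h 0 ∩ h 1 := by rw [hc]; simp
  rw [Finset.mem_inter] at hc'
  obtain ⟨a, b, hab, -⟩ := exists_pair_of_card_three (h3 _ (lp.mem 0 (by omega))) hc'.1
  by_cases hk : 2 < k
  · obtain ⟨e, he⟩ := Finset.card_eq_one.1 (lp.adj 1 (by omega))
    have he' : e ∈ h 1 ∩ h 2 := by rw [he]; simp
    rw [Finset.mem_inter] at he'
    have hce : c ≠ e := by
      rintro rfl
      exact lp.dis 0 2 (by omega) hk _ hc'.1 he'.2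
    have : (((h 1).erase c).erase e).card = 1 := by
      rw [Finset.card_erase_of_mem (by simp; tauto), Finset.card_erase_of_mem hc'.2, h3 _ (lp.mem 1 (by omega))]
    obtain ⟨d, hd⟩ := Finset.card_eq_one.1 this
    refine ⟨a, b, c, d, e, lp, mx, k2, hab, ?_, fun _ => he'.2⟩
    rw [← Finset.insert_erase hc'.2, ← Finset.insert_erase (show e ∈ (h 1).erase c by simp; tauto), hd]
    congr 1
    rw [Finset.pair_comm]
  · obtain ⟨d, e, -, hde⟩ := exists_pair_of_card_three (h3 _ (lp.mem 1 (by omega))) hc'.2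
    exact ⟨a, b, c, d, e, lp, mx, k2, hab, hde, fun h => absurd h hk⟩

theorem card_one_uniq {s t : Finset V} (h : (s ∩ t).card = 1) {x y : V} (hx : x ∈ s) (hx' : x ∈ t)
    (hy : y ∈ s) (hy' : y ∈ t) : x = y :=
  Finset.card_le_one.1 h.le x (Finset.mem_inter.2 ⟨hx, hx'⟩) y (Finset.mem_inter.2 ⟨hy, hy'⟩)

theorem Cfg.nd {E : Finset (Finset V)} (h3 : ∀ e ∈ E, e.card = 3) {h : ℕ → Finset V} {k : ℕ} {a b c d e : V}
    (C : Cfg E h k a b c d e) : a ≠ b ∧ a ≠ c ∧ a ≠ d ∧ a ≠ e ∧ b ≠ c ∧ b ≠ d ∧ b ≠ e ∧ c ≠ d ∧ c ≠ e ∧ d ≠ e := by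
  have k2 := C.k2
  have e0 := C.lp.mem 0 (by omega)
  have e1 := C.lp.mem 1 (by omega)
  have ad := C.lp.adj 0 (by omega)
  simp only [C.h0, C.h1, zero_add] at e0 e1 ad
  obtain ⟨n1, n2, n3⟩ := ne3 h3 e0
  obtain ⟨m1, m2, m3⟩ := ne3 h3 e1
  have u : ∀ x, x ∈ ({a,b,c} : Finset V) → x ∈ ({c,d,e} : Finset V) → x = c :=
    fun x hx hx' => card_one_uniq ad hx hx' (by simp) (by simp)
  refine ⟨n1, n2, ?_, ?_, n3, ?_, ?_, m1, m2, m3⟩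
  · rintro rfl; exact n2 (u a (by simp) (by simp))
  · rintro rfl; exact n2 (u a (by simp) (by simp))
  · rintro rfl; exact n3 (u b (by simp) (by simp))
  · rintro rfl; exact n3 (u b (by simp) (by simp))

section

theorem Cfg.a_not {E : Finset (Finset V)} (h3 : ∀ e ∈ E, e.card = 3) {h : ℕ → Finset V} {k : ℕ} {a b c d e : V}
    (C : Cfg E h k a b c d e)
    {i : ℕ} (hi : 1 ≤ i) (hk : i < k) : a ∉ h i := by
  have nd := C.nd h3
  by_cases h1 : i = 1
  · subst h1; rw [C.h1]; simp; tauto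
  · exact C.lp.dis 0 i (by omega) hk a (by rw [C.h0]; simp)

theorem Cfg.b_not {E : Finset (Finset V)} (h3 : ∀ e ∈ E, e.card = 3) {h : ℕ → Finset V} {k : ℕ} {a b c d e : V}
    (C : Cfg E h k a b c d e)
    {i : ℕ} (hi : 1 ≤ i) (hk : i < k) : b ∉ h i := C.swap.a_not h3 hi hk

theorem Cfg.c_not {E : Finset (Finset V)} (h3 : ∀ e ∈ E, e.card = 3) {h : ℕ → Finset V} {k : ℕ} {a b c d e : V}
    (C : Cfg E h k a b c d e)
    {i : ℕ} (hi : 2 ≤ i) (hk : i < k) : c ∉ h i :=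
  C.lp.dis 0 i (by omega) hk c (by rw [C.h0]; simp)

theorem Cfg.e_not {E : Finset (Finset V)} (h3 : ∀ e ∈ E, e.card = 3) {h : ℕ → Finset V} {k : ℕ} {a b c d e : V}
    (C : Cfg E h k a b c d e)
    {i : ℕ} (hi : 3 ≤ i) (hk : i < k) : e ∉ h i :=
  C.lp.dis 1 i (by omega) hk e (by rw [C.h1]; simp)

theorem Cfg.d_not {E : Finset (Finset V)} (h3 : ∀ e ∈ E, e.card = 3) {h : ℕ → Finset V} {k : ℕ} {a b c d e : V}
    (C : Cfg E h k a b c d e)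
    {i : ℕ} (hi : 2 ≤ i) (hk : i < k) : d ∉ h i := by
  have nd := C.nd h3
  by_cases h2 : i = 2
  · subst h2
    intro hd
    exact nd.2.2.2.2.2.2.2.2.2 (card_one_uniq (C.lp.adj 1 (by omega)) (by rw [C.h1]; simp) hd (by rw [C.h1]; simp) (C.he hk))
  · exact C.lp.dis 1 i (by omega) hk d (by rw [C.h1]; simp)

theorem Cfg.diff_card {E : Finset (Finset V)} (h3 : ∀ e ∈ E, e.card = 3) {h : ℕ → Finset V} {k : ℕ} {a b c d e : V}
    (C : Cfg E h k a b c d e)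
    {i : ℕ} (hi : 1 ≤ i) (hk : i < k) : (h i \ h (i-1)).card = 2 := by
  have := C.lp.adj (i-1) (by omega)
  rw [show i - 1 + 1 = i by omega] at this
  rw [Finset.card_sdiff, this, h3 _ (C.lp.mem i hk)]

theorem Cfg.block {E : Finset (Finset V)} (h3 : ∀ e ∈ E, e.card = 3) {h : ℕ → Finset V} {k : ℕ} {a b c d e : V}
    (C : Cfg E h k a b c d e)
    (hcyc : ¬ HasLinearCycle E) {f : Finset V} (hf : f ∈ E) (ha : a ∈ f) (hb : b ∉ f)
    {i : ℕ} (hi : 1 ≤ i) (hik : i < k) (hfi : (f ∩ h i).card = 1)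
    (hfj : ∀ j, i < j → j < k → ∀ x, x ∈ f → x ∉ h j) {y : V} {m : ℕ} (hm : i ≤ m) (hmk : m < k)
    (hy : y ∈ h m) (hyf : y ∉ f) (hE : ({a,b,y} : Finset V) ∈ E) : False := by
  apply hcyc
  have P : LP E (cons f (fun t => h (t + i))) (k - i + 1) := by
    refine (C.lp.shift i).cons hf (fun _ => by simpa using hfi) ?_
    intro t ht htk x hx
    exact hfj (t+i) (by omega) (by omega) x hx
  refine P.close' h3 hE ?_ y (m - i + 1) (by omega) (by omega) (by simp) ?_ hyf ?_
  · rw [Finset.card_eq_one]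
    refine ⟨a, ?_⟩
    ext x
    simp only [cons, Finset.mem_inter, Finset.mem_insert, Finset.mem_singleton]
    constructor
    · rintro ⟨rfl | rfl | rfl, hx⟩ <;> tauto
    · rintro rfl; tauto
  · simp only [cons]
    rwa [show m - i + i = m by omega]
  · rintro z hz (_ | t) ht htk hzt
    · omega
    · simp only [cons] at hzt
      simp only [Finset.mem_insert, Finset.mem_singleton] at hz
      rcases hz with rfl | rfl | rfl
      · exact absurd hzt (C.a_not h3 (by omega) (by omega))
      · exact absurd hzt (C.b_not h3 (by omega) (by omega))
      · rfl

/-- a later vertex is blocked by a link pair -/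
theorem Cfg.block_diff {E : Finset (Finset V)} (h3 : ∀ e ∈ E, e.card = 3) {h : ℕ → Finset V} {k : ℕ} {a b c d e : V}
    (C : Cfg E h k a b c d e)
    (hcyc : ¬ HasLinearCycle E) {i : ℕ} (hi : 1 ≤ i) (hik : i < k)
    (hp : insert a (h i \ h (i-1)) ∈ E) {y : V} {m : ℕ} (hm : i < m) (hmk : m < k)
    (hy : y ∈ h m) (hyf : y ∉ h i) (hE : ({a,b,y} : Finset V) ∈ E) : False := by
  have nd := C.nd h3
  have hya : y ≠ a := by rintro rfl; exact C.a_not h3 (by omega) hmk hy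
  refine C.block h3 hcyc (f := insert a (h i \ h (i-1))) hp (by simp) ?_ (i := i+1) (by omega) (by omega) ?_ ?_ (m := m) (by omega) hmk hy ?_ hE
  · have := C.b_not h3 hi hik
    simp only [Finset.mem_insert, Finset.mem_sdiff]; tauto
  · refine Eq.trans (congrArg Finset.card ?_) (C.lp.adj i (by omega))
    ext x
    simp only [Finset.mem_inter, Finset.mem_insert, Finset.mem_sdiff]
    constructor
    · rintro ⟨rfl | hx, hx'⟩
      · exact absurd hx' (C.a_not h3 (by omega) (by omega))
      · exact ⟨hx.1, hx'⟩
    · rintro ⟨hx, hx'⟩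
      exact ⟨Or.inr ⟨hx, fun hh => C.lp.dis (i-1) (i+1) (by omega) (by omega) x hh hx'⟩, hx'⟩
  · intro j hj hjk x hx
    simp only [Finset.mem_insert, Finset.mem_sdiff] at hx
    rcases hx with rfl | hx
    · exact C.a_not h3 (by omega) hjk
    · exact C.lp.dis i j (by omega) hjk x hx.1
  · simp only [Finset.mem_insert, Finset.mem_sdiff]; tauto

theorem Cfg.block_ce {E : Finset (Finset V)} (h3 : ∀ e ∈ E, e.card = 3) {h : ℕ → Finset V} {k : ℕ} {a b c d e : V}
    (C : Cfg E h k a b c d e)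
    (hcyc : ¬ HasLinearCycle E) (hp : ({a,c,e} : Finset V) ∈ E) {y : V} {m : ℕ}
    (hm : 2 ≤ m) (hmk : m < k) (hy : y ∈ h m) (hye : y ≠ e) (hE : ({a,b,y} : Finset V) ∈ E) : False := by
  have nd := C.nd h3
  have hya : y ≠ a := by rintro rfl; exact C.a_not h3 (by omega) hmk hy
  have hyc : y ≠ c := by rintro rfl; exact C.c_not h3 hm hmk hy
  refine C.block h3 hcyc (f := {a,c,e}) hp (by simp) ?_ (i := 2) (by omega) (by omega) ?_ ?_ (m := m) (by omega) hmk hy ?_ hE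
  · simp; tauto
  · rw [Finset.card_eq_one]
    refine ⟨e, ?_⟩
    ext x
    simp only [Finset.mem_inter, Finset.mem_insert, Finset.mem_singleton]
    constructor
    · rintro ⟨rfl | rfl | rfl, hx'⟩
      · exact absurd hx' (C.a_not h3 (by omega) (by omega))
      · exact absurd hx' (C.c_not h3 (by omega) (by omega))
      · rfl
    · rintro rfl
      exact ⟨by tauto, C.he (by omega)⟩
  · intro j hj hjk x hx
    simp only [Finset.mem_insert, Finset.mem_singleton] at hx
    rcases hx with rfl | rfl | rfl
    · exact C.a_not h3 (by omega) hjk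
    · exact C.c_not h3 (by omega) hjk
    · exact C.e_not h3 (by omega) hjk
  · simp; tauto

theorem Cfg.acz_inter {E : Finset (Finset V)} (h3 : ∀ e ∈ E, e.card = 3) {h : ℕ → Finset V} {k : ℕ} {a b c d e : V}
    (C : Cfg E h k a b c d e)
    {z : V} (hz : z ∉ VS h k) : (({a,c,z} : Finset V) ∩ h 1).card = 1 := by
  have k2 := C.k2
  rw [Finset.card_eq_one]
  refine ⟨c, ?_⟩
  ext x
  simp only [Finset.mem_inter, Finset.mem_insert, Finset.mem_singleton]
  constructor
  · rintro ⟨rfl | rfl | rfl, hx'⟩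
    · exact absurd hx' (C.a_not h3 (by omega) (by omega))
    · rfl
    · exact absurd (mem_VS.2 ⟨1, by omega, hx'⟩) hz
  · rintro rfl
    exact ⟨by tauto, by rw [C.h1]; simp⟩

theorem Cfg.acz_dis {E : Finset (Finset V)} (h3 : ∀ e ∈ E, e.card = 3) {h : ℕ → Finset V} {k : ℕ} {a b c d e : V}
    (C : Cfg E h k a b c d e)
    {z : V} (hz : z ∉ VS h k) {j : ℕ} (hj : 2 ≤ j) (hjk : j < k) :
    ∀ x, x ∈ ({a,c,z} : Finset V) → x ∉ h j := by
  intro x hx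
  simp only [Finset.mem_insert, Finset.mem_singleton] at hx
  rcases hx with rfl | rfl | rfl
  · exact C.a_not h3 (by omega) hjk
  · exact C.c_not h3 (by omega) hjk
  · exact fun hh => hz (mem_VS.2 ⟨j, hjk, hh⟩)

theorem Cfg.mem_abc {E : Finset (Finset V)} (h3 : ∀ e ∈ E, e.card = 3) {h : ℕ → Finset V} {k : ℕ} {a b c d e : V}
    (C : Cfg E h k a b c d e)
    {x : V} (hx : x = a ∨ x = b ∨ x = c ∨ x = d ∨ x = e) : x ∈ VS h k := by
  have k2 := C.k2
  by_cases hh : x ∈ h 0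
  · exact mem_VS.2 ⟨0, by omega, hh⟩
  · refine mem_VS.2 ⟨1, by omega, ?_⟩
    rw [C.h0] at hh
    rw [C.h1]
    simp only [Finset.mem_insert, Finset.mem_singleton] at hh ⊢; tauto

/-- F2 -/
theorem Cfg.F2 {E : Finset (Finset V)} (h3 : ∀ e ∈ E, e.card = 3) {h : ℕ → Finset V} {k : ℕ} {a b c d e : V}
    (C : Cfg E h k a b c d e)
    (hcyc : ¬ HasLinearCycle E) {z : V} (hz : z ∉ VS h k) (hE : ({a,c,z} : Finset V) ∈ E)
    {y : V} (hy : y ∈ VS h k) (hyc : y ≠ c) : ({a,b,y} : Finset V) ∉ E := by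
  intro hE'
  have k2 := C.k2
  have nd := C.nd h3
  obtain ⟨y1, y2, y3⟩ := ne3 h3 hE'
  obtain ⟨m, hmk, hm⟩ := mem_VS.1 hy
  have hm0 : m ≠ 0 := by
    rintro rfl
    rw [C.h0] at hm
    simp at hm
    tauto
  have hzb : b ≠ z := by rintro rfl; exact hz (C.mem_abc h3 (by tauto))
  have hzy : y ≠ z := by rintro rfl; exact hz hy
  refine C.block h3 hcyc (f := {a,c,z}) hE (by simp) ?_ (i := 1) le_rfl (by omega) (C.acz_inter h3 hz) (fun j hj hjk => C.acz_dis h3 hz hj hjk) (m := m) (by omega) hmk hm ?_ hE'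
  · simp; tauto
  · simp; tauto

/-- F3 -/
theorem Cfg.F3 {E : Finset (Finset V)} (h3 : ∀ e ∈ E, e.card = 3) {h : ℕ → Finset V} {k : ℕ} {a b c d e : V}
    (C : Cfg E h k a b c d e)
    {z : V} (hz : z ∉ VS h k) (hE : ({a,c,z} : Finset V) ∈ E)
    {y : V} (hy : y ∉ VS h k) (hE' : ({a,b,y} : Finset V) ∈ E) : y = z := by
  by_contra hyz
  have k2 := C.k2
  have nd := C.nd h3
  obtain ⟨y1, y2, y3⟩ := ne3 h3 hE'
  have hzb : b ≠ z := by rintro rfl; exact hz (C.mem_abc h3 (by tauto))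
  have hyc : y ≠ c := by rintro rfl; exact hy (C.mem_abc h3 (by tauto))
  have P : LP E (cons {a,c,z} (fun t => h (t + 1))) (k - 1 + 1) := by
    refine (C.lp.shift 1).cons hE (fun _ => by simpa using C.acz_inter h3 hz) ?_
    intro t ht htk x hx
    exact C.acz_dis h3 hz (by omega) (by omega) x hx
  have Q : LP E (cons {a,b,y} (cons {a,c,z} (fun t => h (t + 1)))) (k - 1 + 1 + 1) := by
    refine P.cons hE' (fun _ => ?_) ?_
    · rw [Finset.card_eq_one]
      refine ⟨a, ?_⟩
      ext x
      simp only [cons, Finset.mem_inter, Finset.mem_insert, Finset.mem_singleton]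
      constructor
      · rintro ⟨rfl | rfl | rfl, hx⟩ <;> tauto
      · rintro rfl; tauto
    · rintro (_ | t) ht htk x hx
      · omega
      · simp only [cons]
        simp only [Finset.mem_insert, Finset.mem_singleton] at hx
        rcases hx with rfl | rfl | rfl
        · exact C.a_not h3 (by omega) (by omega)
        · exact C.b_not h3 (by omega) (by omega)
        · exact fun hh => hy (mem_VS.2 ⟨t+1, by omega, hh⟩)
  have := C.mx _ _ Q
  omega
end

section

theorem Cfg.Lform [Fintype V] {E : Finset (Finset V)} (h3 : ∀ e ∈ E, e.card = 3) {h : ℕ → Finset V} {k : ℕ} {a b c d e : V}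
    (C : Cfg E h k a b c d e)
    (hcyc : ¬ HasLinearCycle E) {p : Finset V} (hp : p ∈ L E a b) :
    (∃ r, p = {c,r} ∧ (r = d ∨ r = e ∨ r ∉ VS h k)) ∨ (c ∉ p ∧ ∃ i, 1 ≤ i ∧ i < k ∧ p = h i \ h (i-1)) := by
  classical
  have k2 := C.k2
  have nd := C.nd h3
  rw [mem_L] at hp
  obtain ⟨p1, p2, p3, p4⟩ := hp
  by_cases hc : c ∈ p
  · left
    have : (p.erase c).card = 1 := by rw [Finset.card_erase_of_mem hc]; omega
    obtain ⟨r, hr⟩ := Finset.card_eq_one.1 this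
    have hpr : p = {c, r} := by rw [← hr, Finset.insert_erase hc]
    refine ⟨r, hpr, ?_⟩
    by_contra hcon
    push Not at hcon
    obtain ⟨r1, r2, r3⟩ := hcon
    subst hpr
    obtain ⟨n1, n2, n3⟩ := ne3 h3 p4
    obtain ⟨m, hmk, hm⟩ := mem_VS.1 r3
    have r1' : r ∉ h 1 := by rw [C.h1]; simp; tauto
    have hm0 : m ≠ 0 := by
      rintro rfl
      rw [C.h0] at hm
      simp at hm p3
      tauto
    have hm1 : m ≠ 1 := by rintro rfl; exact r1' hm
    apply hcyc
    refine (C.lp.shift 1).close' h3 p4 ?_ r (m-1) (by omega) (by omega) (by simp) (by rwa [show m - 1 + 1 = m by omega]) (by simpa using r1') ?_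
    · rw [Finset.card_eq_one]
      refine ⟨c, ?_⟩
      ext x
      simp only [zero_add, Finset.mem_inter, Finset.mem_insert, Finset.mem_singleton]
      constructor
      · rintro ⟨rfl | rfl | rfl, hx⟩
        · exact absurd hx (C.a_not h3 (by omega) (by omega))
        · rfl
        · exact absurd hx r1'
      · rintro rfl
        exact ⟨by tauto, by rw [C.h1]; simp⟩
    · intro z hz i hi hik hzi
      simp only [Finset.mem_insert, Finset.mem_singleton] at hz
      rcases hz with rfl | rfl | rfl
      · exact absurd hzi (C.a_not h3 (by omega) (by omega))
      · exact absurd hzi (C.c_not h3 (by omega) (by omega))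
      · rfl
  · right
    refine ⟨hc, ?_⟩
    have c0 : (insert a p ∩ h 0).card = 1 := by
      rw [Finset.card_eq_one]
      refine ⟨a, ?_⟩
      rw [C.h0]
      ext x
      simp only [Finset.mem_inter, Finset.mem_insert, Finset.mem_singleton]
      constructor
      · rintro ⟨hx | hx, hx'⟩
        · exact hx
        · rcases hx' with rfl | rfl | rfl <;> tauto
      · rintro rfl; tauto
    have hex : ∃ j, 1 ≤ j ∧ j < k ∧ ∃ x ∈ insert a p, x ∈ h j := by
      by_contra hcon
      push Not at hcon
      have := C.mx _ _ (C.lp.cons p4 (fun _ => c0) (fun i hi hik x hx => hcon i hi hik x hx))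
      omega
    obtain ⟨a1, a2, x, hx, hxj⟩ := Nat.find_spec hex
    have hmin := fun j (hj : j < Nat.find hex) => Nat.find_min hex hj
    generalize Nat.find hex = j at *
    have hpj : p ⊆ h j := by
      by_contra hps
      apply hcyc
      have hinp : insert a p ∩ h j = p ∩ h j := by
        ext y
        simp only [Finset.mem_inter, Finset.mem_insert]
        constructor
        · rintro ⟨rfl | hy, hy'⟩
          · exact absurd hy' (C.a_not h3 a1 a2)
          · exact ⟨hy, hy'⟩
        · tauto
      refine C.lp.close h3 p4 j a1 a2 c0 ?_ ?_ ?_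
      · have h1 : 0 < (insert a p ∩ h j).card := Finset.card_pos.2 ⟨x, Finset.mem_inter.2 ⟨hx, hxj⟩⟩
        have h2 : (p ∩ h j).card < p.card := by
          apply Finset.card_lt_card
          refine ⟨Finset.inter_subset_left, fun hh => hps (fun y hy => (Finset.mem_inter.1 (hh hy)).2)⟩
        rw [hinp] at h1 ⊢
        omega
      · intro i hi hij y hy hyi
        exact hmin i hij ⟨hi, by omega, y, hy, hyi⟩
      · intro y hy hy0 hyj
        have : y = a := card_one_uniq c0 hy hy0 (by simp) (by rw [C.h0]; simp)
        subst this
        exact C.a_not h3 a1 a2 hyj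
    refine ⟨j, a1, a2, ?_⟩
    apply Finset.eq_of_subset_of_card_le
    · intro y hy
      rw [Finset.mem_sdiff]
      refine ⟨hpj hy, fun hy' => ?_⟩
      by_cases hj : j = 1
      · subst hj
        have : y = a := card_one_uniq c0 (by simp [hy]) hy' (by simp) (by rw [C.h0]; simp)
        subst this
        exact p2 hy
      · exact hmin (j-1) (by omega) ⟨by omega, by omega, y, by simp [hy], hy'⟩
    · rw [C.diff_card h3 a1 a2, p1]
end
end HG
namespace HG
variable {V : Type*} [DecidableEq V] [Fintype V]

theorem card_union3 {α : Type*} [DecidableEq α] {s t u v : Finset α} (h : s ⊆ t ∪ u ∪ v) :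
    s.card ≤ t.card + u.card + v.card :=
  (Finset.card_le_card h).trans ((Finset.card_union_le _ _).trans (Nat.add_le_add_right (Finset.card_union_le _ _) _))

theorem card_union2 {α : Type*} [DecidableEq α] {s t u : Finset α} (h : s ⊆ t ∪ u) :
    s.card ≤ t.card + u.card :=
  (Finset.card_le_card h).trans (Finset.card_union_le _ _)

section

theorem Cfg.VScard {E : Finset (Finset V)} (h3 : ∀ e ∈ E, e.card = 3) {h : ℕ → Finset V} {k : ℕ} {a b c d e : V}
    (C : Cfg E h k a b c d e)
    : (VS h k).card = 2 * k + 1 := by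
  have k2 := C.k2
  have lp := C.lp
  obtain ⟨m, rfl⟩ : ∃ m, k = m + 1 := ⟨k - 1, by omega⟩
  exact VS_card h3 lp

theorem Cfg.off_card {E : Finset (Finset V)} (h3 : ∀ e ∈ E, e.card = 3) {h : ℕ → Finset V} {k : ℕ} {a b c d e : V}
    (C : Cfg E h k a b c d e)
    : (Finset.univ \ VS h k).card + (2 * k + 1) = Fintype.card V := by
  rw [Finset.card_sdiff_of_subset (Finset.subset_univ _), Finset.card_univ, C.VScard h3]
  have := Finset.card_le_univ (VS h k)
  rw [C.VScard h3] at this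
  omega

theorem Cfg.de {E : Finset (Finset V)} (h3 : ∀ e ∈ E, e.card = 3) {h : ℕ → Finset V} {k : ℕ} {a b c d e : V}
    (C : Cfg E h k a b c d e)
    : h 1 \ h 0 = {d,e} := by
  have nd := C.nd h3
  rw [C.h0, C.h1]
  ext x
  simp only [Finset.mem_sdiff, Finset.mem_insert, Finset.mem_singleton]
  grind

theorem Cfg.X1 {E : Finset (Finset V)} (h3 : ∀ e ∈ E, e.card = 3) {h : ℕ → Finset V} {k : ℕ} {a b c d e : V}
    (C : Cfg E h k a b c d e)
    (hcyc : ¬ HasLinearCycle E) (hd : ∀ w, Fintype.card V ≤ hDegree E w + 1)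
    {z : V} (hz : z ∉ VS h k) (habz : ({a,b,z} : Finset V) ∈ E) (hA : A E a b ⊆ {c,z}) :
    2 ≤ ((L E a b).filter (fun p => p ⊆ h 1)).card := by
  have k2 := C.k2
  have nd := C.nd h3
  have hoff := C.off_card h3
  have hpos : 0 < (Finset.univ \ VS h k).card := Finset.card_pos.2 ⟨z, by simp [hz]⟩
  have hsub : L E a b ⊆ (L E a b).filter (fun p => p ⊆ h 1) ∪ {{c,z}} ∪ (Finset.Ico 2 k).image (fun i => h i \ h (i-1)) := by
    intro p hp
    simp only [Finset.mem_union, Finset.mem_filter, Finset.mem_singleton, Finset.mem_image, Finset.mem_Ico]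
    rcases C.Lform h3 hcyc hp with ⟨r, rfl, hr⟩ | ⟨-, i, hi, hik, rfl⟩
    · rcases hr with rfl | rfl | hr
      · left; left; refine ⟨hp, ?_⟩; rw [C.h1]; intro x; simp; tauto
      · left; left; refine ⟨hp, ?_⟩; rw [C.h1]; intro x; simp; tauto
      · left; right
        rw [C.F3 h3 hr (mem_L.1 hp).2.2.2 hz habz]
    · by_cases h1 : i = 1
      · subst h1
        left; left; exact ⟨hp, Finset.sdiff_subset⟩
      · right; exact ⟨i, ⟨by omega, hik⟩, rfl⟩
  have h1 := card_union3 hsub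
  have h2 := deg_le h3 nd.1
  have h4 := hd a
  have h5 := (Finset.card_le_card hA).trans Finset.card_le_two
  have h6 : ((Finset.Ico 2 k).image (fun i => h i \ h (i-1))).card ≤ k - 2 := Finset.card_image_le.trans (by simp)
  rw [Finset.card_singleton] at h1
  omega

theorem Cfg.LM {E : Finset (Finset V)} (h3 : ∀ e ∈ E, e.card = 3) {h : ℕ → Finset V} {k : ℕ} {a b c d e : V}
    (C : Cfg E h k a b c d e)
    (hcyc : ¬ HasLinearCycle E) :
    L E a b ⊆ (insert d (insert e (Finset.univ \ VS h k))).image (fun r => ({c,r} : Finset V)) ∪ (Finset.Ico 1 k).image (fun i => h i \ h (i-1)) := by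
  intro p hp
  simp only [Finset.mem_union, Finset.mem_image, Finset.mem_Ico, Finset.mem_insert, Finset.mem_sdiff, Finset.mem_univ, true_and]
  rcases C.Lform h3 hcyc hp with ⟨r, rfl, hr⟩ | ⟨-, i, hi, hik, rfl⟩
  · left; exact ⟨r, hr, rfl⟩
  · right; exact ⟨i, ⟨hi, hik⟩, rfl⟩

theorem Cfg.Mcard {E : Finset (Finset V)} (h3 : ∀ e ∈ E, e.card = 3) {h : ℕ → Finset V} {k : ℕ} {a b c d e : V}
    (C : Cfg E h k a b c d e)
    : ((insert d (insert e (Finset.univ \ VS h k))).image (fun r => ({c,r} : Finset V)) ∪ (Finset.Ico 1 k).image (fun i => h i \ h (i-1))).card ≤ Fintype.card V - k := by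
  have k2 := C.k2
  have hoff := C.off_card h3
  have h1 : ((insert d (insert e (Finset.univ \ VS h k))).image (fun r => ({c,r} : Finset V))).card ≤ (Finset.univ \ VS h k).card + 1 + 1 :=
    Finset.card_image_le.trans ((Finset.card_insert_le _ _).trans (Nat.add_le_add_right (Finset.card_insert_le _ _) _))
  have h2 : ((Finset.Ico 1 k).image (fun i => h i \ h (i-1))).card ≤ k - 1 := Finset.card_image_le.trans (by simp)
  have h4 := Finset.card_union_le ((insert d (insert e (Finset.univ \ VS h k))).image (fun r => ({c,r} : Finset V))) ((Finset.Ico 1 k).image (fun i => h i \ h (i-1)))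
  omega

theorem Cfg.X2 {E : Finset (Finset V)} (h3 : ∀ e ∈ E, e.card = 3) {h : ℕ → Finset V} {k : ℕ} {a b c d e : V}
    (C : Cfg E h k a b c d e)
    (hcyc : ¬ HasLinearCycle E) (hd : ∀ w, Fintype.card V ≤ hDegree E w + 1)
    (hA : A E a b ⊆ {c}) : k = 2 ∧ {c,d} ∈ L E a b ∧ {d,e} ∈ L E a b := by
  have k2 := C.k2
  have nd := C.nd h3
  have hoff := C.off_card h3
  have h2 := deg_le h3 nd.1
  have h4 := hd a
  have h5 := (Finset.card_le_card hA)
  rw [Finset.card_singleton] at h5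
  have h6 := Finset.card_le_card (C.LM h3 hcyc)
  have h7 := C.Mcard h3
  have hk : k = 2 := by omega
  have heq := Finset.eq_of_subset_of_card_le (C.LM h3 hcyc) (by omega)
  refine ⟨hk, ?_, ?_⟩
  · rw [heq]; apply Finset.mem_union_left; apply Finset.mem_image_of_mem; simp
  · rw [heq]; apply Finset.mem_union_right
    rw [← C.de h3]
    exact Finset.mem_image_of_mem (fun i => h i \ h (i-1)) (by simp; omega)

theorem Cfg.X {E : Finset (Finset V)} (h3 : ∀ e ∈ E, e.card = 3) {h : ℕ → Finset V} {k : ℕ} {a b c d e : V}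
    (C : Cfg E h k a b c d e)
    (hcyc : ¬ HasLinearCycle E) (hd : ∀ w, Fintype.card V ≤ hDegree E w + 1)
    {z : V} (hz : z ∉ VS h k) : ({a,c,z} : Finset V) ∉ E := by
  intro hE
  have k2 := C.k2
  have nd := C.nd h3
  have hA : A E a b ⊆ {c, z} := by
    intro y hy
    rw [mem_A] at hy
    simp only [Finset.mem_insert, Finset.mem_singleton]
    by_contra hcon
    push Not at hcon
    by_cases hyV : y ∈ VS h k
    · exact C.F2 h3 hcyc hz hE hyV hcon.1 hy.2.2
    · exact hcon.2 (C.F3 h3 hz hE hyV hy.2.2)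
  by_cases habz : ({a,b,z} : Finset V) ∈ E
  · have x1 := C.X1 h3 hcyc hd hz habz hA
    have x2 := C.swap.X1 h3 hcyc hd hz (by rwa [Finset.insert_comm]) (by rwa [A_comm])
    obtain ⟨q, hq⟩ := Finset.card_pos.1 (show 0 < ((L E b a).filter (fun p => p ⊆ h 1)).card by omega)
    obtain ⟨p, hp, hpq⟩ := Finset.exists_mem_ne (show 1 < ((L E a b).filter (fun p => p ⊆ h 1)).card by omega) q
    rw [Finset.mem_filter] at hp hq
    refine XT h3 hcyc (s := h 1) (h3 _ (C.lp.mem 1 (by omega))).le (C.a_not h3 le_rfl (by omega)) (C.b_not h3 le_rfl (by omega)) (fun hh => hz (mem_VS.2 ⟨1, by omega, hh⟩)) hp.2 hq.2 hpq hp.1 hq.1 habz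
  · have hA' : A E a b ⊆ {c} := by
      intro y hy
      have := hA hy
      simp only [Finset.mem_insert, Finset.mem_singleton] at this ⊢
      rcases this with rfl | rfl
      · rfl
      · exact absurd (mem_A.1 hy).2.2 habz
    obtain ⟨-, -, u2⟩ := C.X2 h3 hcyc hd hA'
    obtain ⟨-, v1, -⟩ := C.swap.X2 h3 hcyc hd (by rwa [A_comm])
    rw [mem_L] at u2 v1
    have hza : z ≠ a := by rintro rfl; exact hz (C.mem_abc h3 (by tauto))
    have hzb : z ≠ b := by rintro rfl; exact hz (C.mem_abc h3 (by tauto))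
    have hzc : z ≠ c := by rintro rfl; exact hz (C.mem_abc h3 (by tauto))
    have hzd : z ≠ d := by rintro rfl; exact hz (C.mem_abc h3 (by tauto))
    have hze : z ≠ e := by rintro rfl; exact hz (C.mem_abc h3 (by tauto))
    refine tri h3 hcyc a z c b d e ?_ (meq hE ?_) (meq v1.2.2.2 ?_) (meq u2.2.2.2 ?_)
    · simp only [List.nodup_cons, List.mem_cons, List.not_mem_nil, or_false, not_or, List.nodup_nil, not_false_eq_true, and_true]
      clear * - nd hza hzb hzc hzd hze
      grind
    all_goals (clear * -; ext t; simp only [Finset.mem_insert, Finset.mem_singleton]; tauto)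

/-- simplified form of the link -/
theorem Cfg.Lform' {E : Finset (Finset V)} (h3 : ∀ e ∈ E, e.card = 3) {h : ℕ → Finset V} {k : ℕ} {a b c d e : V}
    (C : Cfg E h k a b c d e)
    (hcyc : ¬ HasLinearCycle E) (hd : ∀ w, Fintype.card V ≤ hDegree E w + 1) {p : Finset V} (hp : p ∈ L E a b) :
    p = {c,d} ∨ p = {c,e} ∨ (c ∉ p ∧ ∃ i, 1 ≤ i ∧ i < k ∧ p = h i \ h (i-1)) := by
  rcases C.Lform h3 hcyc hp with ⟨r, rfl, hr⟩ | hh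
  · rcases hr with rfl | rfl | hr
    · tauto
    · tauto
    · exact absurd (mem_L.1 hp).2.2.2 (C.X h3 hcyc hd hr)
  · tauto
end

theorem Y2 {E : Finset (Finset V)} (h3 : ∀ e ∈ E, e.card = 3) (hcyc : ¬ HasLinearCycle E)
    (hd : ∀ w, Fintype.card V ≤ hDegree E w + 1) (hn : 6 ≤ Fintype.card V)
    {a b c d x y : V} (hab : a ≠ b) (hac : a ≠ c) (had : a ≠ d) (hbc : b ≠ c) (hbd : b ≠ d) (hcd : c ≠ d)
    (hx : x ≠ a ∧ x ≠ b ∧ x ≠ c ∧ x ≠ d) (hy : y ≠ a ∧ y ≠ b ∧ y ≠ c ∧ y ≠ d)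
    (e1 : ({a,b,c} : Finset V) ∈ E) (e2 : ({a,c,d} : Finset V) ∈ E) (e3 : ({a,x,y} : Finset V) ∈ E)
    (hA4 : 4 ≤ (A E a b).card) (hcv : ∀ v, {c,v} ∈ L E a b → v = d)
    (hstar : ∀ u v, u ≠ v → u ≠ a → u ≠ b → v ≠ a → v ≠ b → ({u,v} : Finset V) ≠ {x,y} → u ∈ A E a b ∨ v ∈ A E a b) :
    False := by
  obtain ⟨-, -, hxy⟩ := ne3 h3 e3
  have key : ∀ v, v ≠ c → v ≠ d → v ≠ a → ({c,a,v} : Finset V) ∈ E → v = b := by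
    intro v v1 v2 v3 hE
    by_contra hvb
    exact v2 (hcv v (mem_L_pair h3 (meq hE (by clear * -; ext; simp; tauto)) (Ne.symm hbc) hvb))
  have key2 : ∀ v, v ≠ c → v ≠ d → v ≠ a → v ≠ b → ({c,b,v} : Finset V) ∈ E → False := by
    intro v v1 v2 v3 v4 hE
    obtain ⟨u, huA, hu⟩ : ∃ u ∈ A E a b, u ∉ ({c,d,v} : Finset V) := by
      by_contra hcon
      push Not at hcon
      have := (Finset.card_le_card hcon).trans Finset.card_le_three
      omega
    simp only [Finset.mem_insert, Finset.mem_singleton, not_or] at hu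
    rw [mem_A] at huA
    refine tri h3 hcyc a d c v b u ?_ (meq e2 ?_) (meq hE ?_) (meq huA.2.2 ?_)
    · simp only [List.nodup_cons, List.mem_cons, List.not_mem_nil, or_false, not_or, List.nodup_nil, not_false_eq_true, and_true]
      clear hstar hcv key e1 e2 e3 hx hy
      grind
    all_goals (clear * -; ext t; simp only [Finset.mem_insert, Finset.mem_singleton]; tauto)
  have key3 : ∀ u v, u ∈ A E a b → u ≠ v → u ≠ c → u ≠ d → v ≠ c → v ≠ d → v ≠ a → v ≠ b → ({c,u,v} : Finset V) ∈ E → False := by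
    intro u v huA huv u1 u2 v1 v2 v3 v4 hE
    rw [mem_A] at huA
    refine tri h3 hcyc a d c v u b ?_ (meq e2 ?_) (meq hE ?_) (meq huA.2.2 ?_)
    · simp only [List.nodup_cons, List.mem_cons, List.not_mem_nil, or_false, not_or, List.nodup_nil, not_false_eq_true, and_true]
      clear hstar hcv key key2 e1 e2 e3 hx hy
      grind
    all_goals (clear * -; ext t; simp only [Finset.mem_insert, Finset.mem_singleton]; tauto)
  have hL : L E c d ⊆ {{a,b},{x,y}} := by
    intro p hp
    rw [mem_L] at hp
    obtain ⟨p1, p2, p3, p4⟩ := hp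
    obtain ⟨u, v, huv, rfl⟩ := Finset.card_eq_two.1 p1
    simp only [Finset.mem_insert, Finset.mem_singleton, not_or] at p2 p3 ⊢
    have cu : c ≠ u := p2.1
    have cv : c ≠ v := p2.2
    have du : d ≠ u := p3.1
    have dv : d ≠ v := p3.2
    have p4' : ({c,v,u} : Finset V) ∈ E := meq p4 (by clear * -; ext; simp; tauto)
    by_cases ua : u = a
    · subst ua
      rw [key v cv.symm dv.symm huv.symm p4]; left; rfl
    by_cases va : v = a
    · subst va
      rw [key u cu.symm du.symm huv p4', Finset.pair_comm]; left; rfl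
    by_cases ub : u = b
    · subst ub
      exact (key2 v cv.symm dv.symm va huv.symm p4).elim
    by_cases vb : v = b
    · subst vb
      exact (key2 u cu.symm du.symm ua huv p4').elim
    by_contra hcon
    push Not at hcon
    rcases hstar u v huv ua ub va vb hcon.2 with hu | hv
    · exact key3 u v hu huv cu.symm du.symm cv.symm dv.symm va vb p4
    · exact key3 v u hv huv.symm cv.symm dv.symm cu.symm du.symm ua ub p4'
  have hA : A E c d ⊆ Finset.univ \ {c,d,x,y} := by
    have gen : ∀ x y, x ≠ y → (x ≠ a ∧ x ≠ b ∧ x ≠ c ∧ x ≠ d) → (y ≠ a ∧ y ≠ b ∧ y ≠ c ∧ y ≠ d) → ({a,x,y} : Finset V) ∈ E → ({c,d,x} : Finset V) ∉ E := by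
      intro x y hxy hx hy e3 hE
      refine tri h3 hcyc c d x y a b ?_ hE (meq e3 ?_) e1
      · simp only [List.nodup_cons, List.mem_cons, List.not_mem_nil, or_false, not_or, List.nodup_nil, not_false_eq_true, and_true]
        clear hstar hcv key key2 key3 e1 e2 e3
        grind
      all_goals (clear * -; ext t; simp only [Finset.mem_insert, Finset.mem_singleton]; tauto)
    intro t ht
    rw [mem_A] at ht
    simp only [Finset.mem_sdiff, Finset.mem_univ, true_and, Finset.mem_insert, Finset.mem_singleton, not_or]
    refine ⟨ht.1, ht.2.1, ?_, ?_⟩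
    · rintro rfl
      exact gen _ y hxy hx hy e3 ht.2.2
    · rintro rfl
      exact gen _ x hxy.symm hy hx (meq e3 (by clear * -; ext; simp; tauto)) ht.2.2
  have c1 := (Finset.card_le_card hL).trans Finset.card_le_two
  have c2 := Finset.card_le_card hA
  rw [Finset.card_sdiff_of_subset (Finset.subset_univ _), Finset.card_univ] at c2
  have c3 : ({c,d,x,y} : Finset V).card = 4 := by
    rw [Finset.card_insert_of_notMem, Finset.card_insert_of_notMem, Finset.card_pair hxy]
    · simp only [Finset.mem_insert, Finset.mem_singleton, not_or]; exact ⟨hx.2.2.2.symm, hy.2.2.2.symm⟩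
    · simp only [Finset.mem_insert, Finset.mem_singleton, not_or]; exact ⟨hcd, hx.2.2.1.symm, hy.2.2.1.symm⟩
  have c4 := deg_le h3 hcd
  have c5 := hd c
  omega
end HG
namespace HG
variable {V : Type*} [DecidableEq V] [Fintype V]

section

theorem Cfg.diff_dis {E : Finset (Finset V)} {h : ℕ → Finset V} {k : ℕ} {a b c d e : V}
    (C : Cfg E h k a b c d e)
    {i j : ℕ} (hij : i < j) (hjk : j < k) {x : V} (hx : x ∈ h j \ h (j-1)) : x ∉ h i := by
  intro hx'
  rw [Finset.mem_sdiff] at hx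
  by_cases h1 : i = j - 1
  · subst h1; exact hx.2 hx'
  · exact C.lp.dis i j (by omega) hjk x hx' hx.1

/-- no far vertex in `A a b` except `e` -/
theorem Cfg.Y {E : Finset (Finset V)} (h3 : ∀ e ∈ E, e.card = 3) {h : ℕ → Finset V} {k : ℕ} {a b c d e : V}
    (C : Cfg E h k a b c d e)
    (hcyc : ¬ HasLinearCycle E) (hd : ∀ w, Fintype.card V ≤ hDegree E w + 1)
    (k3 : 3 ≤ k) (hL2 : 2 ≤ (L E a b).card) :
    ∀ y m, 2 ≤ m → m < k → y ∈ h m → ({a,b,y} : Finset V) ∈ E → y = e := by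
  intro y m hm hmk hy hE
  by_contra hye
  have nd := C.nd h3
  have hoff := C.off_card h3
  have hL : ∀ p ∈ L E a b, p = {c,d} ∨ (c ∉ p ∧ ∃ i, 2 ≤ i ∧ i < k ∧ p = h i \ h (i-1)) := by
    intro p hp
    rcases C.Lform' h3 hcyc hd hp with rfl | rfl | ⟨hc, i, hi, hik, rfl⟩
    · left; rfl
    · exact (C.block_ce h3 hcyc (mem_L.1 hp).2.2.2 hm hmk hy hye hE).elim
    · right
      refine ⟨hc, i, ?_, hik, rfl⟩
      by_contra hi2
      obtain rfl : i = 1 := by omega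
      refine C.block_diff h3 hcyc hi hik (mem_L.1 hp).2.2.2 (m := m) (by omega) hmk hy ?_ hE
      rw [C.h1]
      simp only [Finset.mem_insert, Finset.mem_singleton, not_or]
      refine ⟨?_, ?_, hye⟩
      · rintro rfl; exact C.c_not h3 hm hmk hy
      · rintro rfl; exact C.d_not h3 hm hmk hy
  obtain ⟨D, hDdef⟩ : ∃ D, D = (L E a b).filter (fun p => c ∉ p) := ⟨_, rfl⟩
  obtain ⟨D', hD'def⟩ : ∃ D', D' = D.filter (fun p => Disjoint p (A E a b)) := ⟨_, rfl⟩
  have hDL : ∀ p ∈ D, p ∈ L E a b := by intro p hp; rw [hDdef, Finset.mem_filter] at hp; exact hp.1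
  have hD : ∀ p ∈ D, ∃ i, 2 ≤ i ∧ i < k ∧ p = h i \ h (i-1) := by
    intro p hp
    rw [hDdef, Finset.mem_filter] at hp
    rcases hL p hp.1 with rfl | ⟨-, hh⟩
    · exact absurd hp.2 (by simp)
    · exact hh
  have hD'D : D' ⊆ D := by rw [hD'def]; exact Finset.filter_subset _ _
  have hdisj : ∀ p ∈ D, ∀ q ∈ D, p ≠ q → Disjoint p q := by
    intro p hp q hq hpq
    obtain ⟨i, hi, hik, rfl⟩ := hD p hp
    obtain ⟨j, hj, hjk, rfl⟩ := hD q hq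
    rcases lt_trichotomy i j with hij | rfl | hij
    · rw [Finset.disjoint_right]
      intro x hx hx'
      exact C.diff_dis hij hjk hx (Finset.mem_sdiff.1 hx').1
    · exact absurd rfl hpq
    · rw [Finset.disjoint_left]
      intro x hx hx'
      exact C.diff_dis hij hik hx (Finset.mem_sdiff.1 hx').1
  have hord : ∀ i j, 2 ≤ i → i < j → j < k → h i \ h (i-1) ∈ D → Disjoint (h j \ h (j-1)) (A E a b) := by
    intro i j hi hij hjk hp
    rw [Finset.disjoint_left]
    intro x hx hxA
    exact C.block_diff h3 hcyc (by omega) (by omega) (mem_L.1 (hDL _ hp)).2.2.2 hij hjk (Finset.mem_sdiff.1 hx).1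
      (C.diff_dis hij hjk hx) (mem_A.1 hxA).2.2
  have hone : (D \ D').card ≤ 1 := by
    rw [Finset.card_le_one]
    intro p hp q hq
    rw [hD'def, Finset.mem_sdiff, Finset.mem_filter, not_and] at hp hq
    obtain ⟨i, hi, hik, rfl⟩ := hD p hp.1
    obtain ⟨j, hj, hjk, rfl⟩ := hD q hq.1
    rcases lt_trichotomy i j with hij | rfl | hij
    · exact absurd (hord i j hi hij hjk hp.1) (hq.2 hq.1)
    · rfl
    · exact absurd (hord j i hj hij hik hq.1) (hp.2 hp.1)
  have hDc : (D \ D').card + D'.card = D.card := Finset.card_sdiff_add_card_eq_card hD'D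
  have hU : (D'.biUnion id).card = 2 * D'.card := by
    rw [Finset.card_biUnion]
    · rw [Finset.sum_congr rfl (fun p hp => show (id p).card = 2 from (mem_L.1 (hDL p (hD'D hp))).1)]
      simp [mul_comm]
    · intro p hp q hq hpq
      exact hdisj p (hD'D hp) q (hD'D hq) hpq
  have hUA : Disjoint (D'.biUnion id) (A E a b) := by
    rw [Finset.disjoint_biUnion_left]
    intro p hp
    rw [hD'def, Finset.mem_filter] at hp
    exact hp.2
  have hUAs : D'.biUnion id ∪ A E a b ⊆ Finset.univ \ {a,b} := by
    apply Finset.union_subset _ (A_sub E a b)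
    intro x hx
    rw [Finset.mem_biUnion] at hx
    obtain ⟨p, hp, hxp⟩ := hx
    have hp' := mem_L.1 (hDL p (hD'D hp))
    simp only [Finset.mem_sdiff, Finset.mem_univ, true_and, Finset.mem_insert, Finset.mem_singleton, not_or]
    exact ⟨fun hh => hp'.2.1 (hh ▸ hxp), fun hh => hp'.2.2.1 (hh ▸ hxp)⟩
  have hc1 := Finset.card_le_card hUAs
  rw [Finset.card_union_of_disjoint hUA, hU, card_univ_sub nd.1] at hc1
  have hLs : L E a b ⊆ insert {c,d} D := by
    intro p hp
    rw [Finset.mem_insert, hDdef, Finset.mem_filter]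
    rcases hL p hp with rfl | hh
    · left; rfl
    · right; exact ⟨hp, hh.1⟩
  have hLc := (Finset.card_le_card hLs).trans (Finset.card_insert_le _ _)
  have hdeg := deg_le h3 nd.1 (E := E)
  have hda := hd a
  have hcd : {c,d} ∈ L E a b := by
    by_contra hcd
    have hLs' : L E a b ⊆ D := by
      intro p hp
      rcases Finset.mem_insert.1 (hLs hp) with rfl | hh
      · exact absurd hp hcd
      · exact hh
    have := Finset.card_le_card hLs'
    omega
  have hDk : D.card ≤ k - 2 := by
    have : D ⊆ (Finset.Ico 2 k).image (fun i => h i \ h (i-1)) := by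
      intro p hp
      obtain ⟨i, hi, hik, rfl⟩ := hD p hp
      exact Finset.mem_image_of_mem (fun i => h i \ h (i-1)) (Finset.mem_Ico.2 ⟨hi, hik⟩)
    exact (Finset.card_le_card this).trans (Finset.card_image_le.trans (by simp))
  have hD'1 : D'.card ≤ 1 := by omega
  obtain ⟨p, hpD, hpS⟩ : ∃ p ∈ D, ∀ u v, u ≠ v → u ≠ a → u ≠ b → v ≠ a → v ≠ b → ({u,v} : Finset V) ≠ p → u ∈ A E a b ∨ v ∈ A E a b := by
    by_cases h0 : D'.card = 0
    · obtain ⟨p, hp⟩ := Finset.card_pos.1 (show 0 < D.card by omega)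
      refine ⟨p, hp, ?_⟩
      intro u v huv ua ub va vb _
      by_contra hcon
      push Not at hcon
      have hdd : Disjoint ({u,v} : Finset V) (A E a b) := by
        rw [Finset.disjoint_left]
        intro x hx
        simp only [Finset.mem_insert, Finset.mem_singleton] at hx
        rcases hx with rfl | rfl
        · exact hcon.1
        · exact hcon.2
      have hss : {u,v} ∪ A E a b ⊆ Finset.univ \ {a,b} := by
        apply Finset.union_subset _ (A_sub E a b)
        intro x hx
        simp only [Finset.mem_insert, Finset.mem_singleton] at hx
        simp only [Finset.mem_sdiff, Finset.mem_univ, true_and, Finset.mem_insert, Finset.mem_singleton, not_or]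
        rcases hx with rfl | rfl
        · exact ⟨ua, ub⟩
        · exact ⟨va, vb⟩
      have := Finset.card_le_card hss
      rw [Finset.card_union_of_disjoint hdd, Finset.card_pair huv, card_univ_sub nd.1] at this
      omega
    · have h1 : D'.card = 1 := by omega
      obtain ⟨p, hp⟩ := Finset.card_eq_one.1 h1
      have hpD' : p ∈ D' := by rw [hp]; simp
      refine ⟨p, hD'D hpD', ?_⟩
      have heq : D'.biUnion id ∪ A E a b = Finset.univ \ {a,b} := by
        apply Finset.eq_of_subset_of_card_le hUAs
        rw [Finset.card_union_of_disjoint hUA, hU, card_univ_sub nd.1]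
        omega
      intro u v huv ua ub va vb hne
      by_contra hcon
      push Not at hcon
      have gen : ∀ u, u ≠ a → u ≠ b → u ∉ A E a b → u ∈ p := by
        intro u ua ub hu
        have : u ∈ D'.biUnion id ∪ A E a b := by
          rw [heq]; simp only [Finset.mem_sdiff, Finset.mem_univ, true_and, Finset.mem_insert, Finset.mem_singleton, not_or]
          exact ⟨ua, ub⟩
        rw [hp] at this
        simpa [hu] using this
      apply hne
      apply Finset.eq_of_subset_of_card_le
      · intro x hx
        simp only [Finset.mem_insert, Finset.mem_singleton] at hx
        rcases hx with rfl | rfl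
        · exact gen _ ua ub hcon.1
        · exact gen _ va vb hcon.2
      · rw [Finset.card_pair huv, (mem_L.1 (hDL p (hD'D hpD'))).1]
  have hpL := mem_L.1 (hDL p hpD)
  obtain ⟨x, z, hxz, rfl⟩ := Finset.card_eq_two.1 hpL.1
  obtain ⟨i, hi, hik, hpi⟩ := hD _ hpD
  have hmem : ∀ w ∈ ({x,z} : Finset V), w ≠ a ∧ w ≠ b ∧ w ≠ c ∧ w ≠ d := by
    intro w hw
    rw [hpi] at hw
    have hw' := (Finset.mem_sdiff.1 hw).1
    refine ⟨?_, ?_, ?_, ?_⟩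
    · rintro rfl; exact C.a_not h3 (by omega) hik hw'
    · rintro rfl; exact C.b_not h3 (by omega) hik hw'
    · rintro rfl; exact C.c_not h3 (by omega) hik hw'
    · rintro rfl; exact C.d_not h3 (by omega) hik hw'
  have e1 := C.lp.mem 0 (by omega)
  rw [C.h0] at e1
  obtain ⟨n1, n2, n3, n4, n5, n6, n7, n8, n9, n10⟩ := nd
  refine Y2 h3 hcyc hd (by omega) n1 n2 n3 n5 n6 n8 (hmem x (by simp)) (hmem z (by simp)) e1 (mem_L.1 hcd).2.2.2 hpL.2.2.2 ?_ ?_ hpS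
  · omega
  · intro v hv
    rcases hL _ hv with hh | hh
    · have hvc : v ≠ c := by
        rintro rfl
        have := (mem_L.1 hv).1
        simp at this
      have : v ∈ ({c,d} : Finset V) := by rw [← hh]; simp
      simp only [Finset.mem_insert, Finset.mem_singleton] at this
      tauto
    · exact absurd hh.1 (by simp)

theorem Cfg.YY {E : Finset (Finset V)} (h3 : ∀ e ∈ E, e.card = 3) {h : ℕ → Finset V} {k : ℕ} {a b c d e : V}
    (C : Cfg E h k a b c d e)
    (hcyc : ¬ HasLinearCycle E) (hd : ∀ w, Fintype.card V ≤ hDegree E w + 1)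
    (k3 : 3 ≤ k) (hng : ¬ ((L E a b).card ≤ 1 ∧ (L E b a).card ≤ 1)) :
    ∀ y m, 2 ≤ m → m < k → y ∈ h m → ({a,b,y} : Finset V) ∈ E → y = e := by
  by_cases h1 : (L E a b).card ≤ 1
  · have h2 : 2 ≤ (L E b a).card := by
      by_contra hh; exact hng ⟨h1, by omega⟩
    intro y m hm hmk hy hE
    exact C.swap.Y h3 hcyc hd k3 h2 y m hm hmk hy (by rwa [Finset.insert_comm])
  · exact C.Y h3 hcyc hd k3 (by omega)

theorem Cfg.last_not {E : Finset (Finset V)} (h3 : ∀ e ∈ E, e.card = 3) {h : ℕ → Finset V} {k : ℕ} {a b c d e : V}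
    (C : Cfg E h k a b c d e)
    (k3 : 3 ≤ k) {h' : ℕ → Finset V} {a' b' c' d' e' : V} (C' : Cfg E h' k a' b' c' d' e')
    (hh : ∀ i, i < k → h' i = h (k-1-i))
    (bad : ∀ y m, 2 ≤ m → m < k → y ∈ h' m → ({a',b',y} : Finset V) ∈ E → y = e') :
    h (k-1) \ h (k-1-1) ∉ L E a b := by
  intro hp
  have nd' := C'.nd h3
  have e0 : h (k-1) \ h (k-1-1) = {a',b'} := by
    have q0 := hh 0 (by omega)
    have q1 := hh 1 (by omega)
    rw [show k - 1 - 0 = k - 1 by omega] at q0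
    rw [← q0, ← q1, C'.h0, C'.h1]
    ext x
    simp only [Finset.mem_sdiff, Finset.mem_insert, Finset.mem_singleton]
    clear hp bad hh q0 q1
    grind
  rw [e0] at hp
  have ha : a ∈ h' (k-1) := by
    rw [hh _ (by omega), show k - 1 - (k-1) = 0 by omega, C.h0]; simp
  have hae : a = e' := bad a (k-1) (by omega) (by omega) ha (meq (mem_L.1 hp).2.2.2 (by clear * -; ext; simp; tauto))
  have : a ∈ h' 1 := by rw [hae, C'.h1]; simp
  rw [hh 1 (by omega)] at this
  exact C.a_not h3 (by omega) (by omega) this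

theorem Cfg.Z {E : Finset (Finset V)} (h3 : ∀ e ∈ E, e.card = 3) {h : ℕ → Finset V} {k : ℕ} {a b c d e : V}
    (C : Cfg E h k a b c d e)
    (hcyc : ¬ HasLinearCycle E) (hd : ∀ w, Fintype.card V ≤ hDegree E w + 1) (k3 : 3 ≤ k)
    (bad : ∀ y m, 2 ≤ m → m < k → y ∈ h m → ({a,b,y} : Finset V) ∈ E → y = e)
    (hlast : h (k-1) \ h (k-1-1) ∉ L E a b) :
    k = 3 ∧ ∀ p, p ⊆ h 1 → p.card = 2 → insert a p ∈ E := by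
  have nd := C.nd h3
  have hoff := C.off_card h3
  have hA : A E a b ⊆ h 1 ∪ (Finset.univ \ VS h k) := by
    intro y hy
    rw [mem_A] at hy
    rw [Finset.mem_union, Finset.mem_sdiff]
    by_contra hcon
    push Not at hcon
    obtain ⟨m, hmk, hm⟩ := mem_VS.1 (hcon.2 (Finset.mem_univ _))
    have m1 : m ≠ 1 := by rintro rfl; exact hcon.1 hm
    have m0 : m ≠ 0 := by
      rintro rfl
      rw [C.h0] at hm
      simp only [Finset.mem_insert, Finset.mem_singleton] at hm
      rcases hm with hm | hm | hm
      · exact hy.1 hm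
      · exact hy.2.1 hm
      · apply hcon.1; rw [hm, C.h1]; simp
    apply hcon.1
    rw [bad y m (by omega) hmk hm hy.2.2, C.h1]; simp
  have hLs : L E a b ⊆ (h 1).powersetCard 2 ∪ (Finset.Ico 2 (k-1)).image (fun i => h i \ h (i-1)) := by
    intro p hp
    rw [Finset.mem_union, Finset.mem_powersetCard]
    rcases C.Lform' h3 hcyc hd hp with rfl | rfl | ⟨hc, i, hi, hik, rfl⟩
    · left; refine ⟨?_, (mem_L.1 hp).1⟩; rw [C.h1]; intro x; simp; tauto
    · left; refine ⟨?_, (mem_L.1 hp).1⟩; rw [C.h1]; intro x; simp; tauto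
    · by_cases h1 : i = 1
      · subst h1; left; exact ⟨Finset.sdiff_subset, (mem_L.1 hp).1⟩
      · right
        refine Finset.mem_image_of_mem (fun i => h i \ h (i-1)) (Finset.mem_Ico.2 ⟨by omega, ?_⟩)
        by_contra hcon
        obtain rfl : i = k - 1 := by omega
        exact hlast hp
  have c1 := card_union2 hA
  have c2 := card_union2 hLs
  have c3 : (h 1).card = 3 := h3 _ (C.lp.mem 1 (by omega))
  have c4 : ((Finset.Ico 2 (k-1)).image (fun i => h i \ h (i-1))).card ≤ k - 1 - 2 := Finset.card_image_le.trans (by simp)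
  have c5 : ((h 1).powersetCard 2).card = 3 := by rw [Finset.card_powersetCard, c3]; rfl
  have c6 := deg_le h3 nd.1
  have c7 := hd a
  have hk : k = 3 := by omega
  refine ⟨hk, ?_⟩
  have hLs' : L E a b ⊆ (h 1).powersetCard 2 := by
    intro p hp
    have := hLs hp
    rw [hk] at this
    simpa using this
  have heq := Finset.eq_of_subset_of_card_le hLs' (by omega)
  intro p hp hp2
  have : p ∈ L E a b := by rw [heq, Finset.mem_powersetCard]; exact ⟨hp, hp2⟩
  exact (mem_L.1 this).2.2.2

theorem Cfg.fin3 {E : Finset (Finset V)} (h3 : ∀ e ∈ E, e.card = 3) {h : ℕ → Finset V} {k : ℕ} {a b c d e : V}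
    (C : Cfg E h k a b c d e)
    (hcyc : ¬ HasLinearCycle E) (hd : ∀ w, Fintype.card V ≤ hDegree E w + 1) (k3 : 3 ≤ k)
    (hng : ∀ a b : V, a ≠ b → ¬ ((L E a b).card ≤ 1 ∧ (L E b a).card ≤ 1)) : False := by
  obtain ⟨a', b', c', d', e', C'⟩ := Cfg.exists h3 C.lp.rev C.mx C.k2
  have nd := C.nd h3
  have nd' := C'.nd h3
  have bad := C.YY h3 hcyc hd k3 (hng _ _ nd.1)
  have bad' := C'.YY h3 hcyc hd k3 (hng _ _ nd'.1)
  have l1 := C.last_not h3 k3 C' (fun i _ => rfl) bad'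
  have l2 := C'.last_not h3 k3 C (fun i hi => by
    show h i = h (k - 1 - (k - 1 - i)); congr 1; omega) bad
  obtain ⟨hk, z1⟩ := C.Z h3 hcyc hd k3 bad l1
  obtain ⟨-, z2⟩ := C'.Z h3 hcyc hd k3 bad' l2
  subst hk
  have n1 : a' ∉ h 1 := C'.a_not h3 (i := 1) (by omega) (by omega)
  have n0 : a' ∉ h 0 := C'.a_not h3 (i := 2) (by omega) (by omega)
  have y1 := z1 {d,e} (by rw [C.h1]; intro x; simp; tauto) (Finset.card_pair nd.2.2.2.2.2.2.2.2.2)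
  have y2 := z2 {c,d} (by show _ ⊆ h 1; rw [C.h1]; intro x; simp; tauto) (Finset.card_pair nd.2.2.2.2.2.2.2.1)
  have e0 := C.lp.mem 0 (by omega)
  rw [C.h0] at e0 n0
  rw [C.h1] at n1
  simp only [Finset.mem_insert, Finset.mem_singleton, not_or] at n0 n1
  refine tri h3 hcyc a e d a' c b ?_ (meq y1 ?_) (meq y2 ?_) (meq e0 ?_)
  · simp only [List.nodup_cons, List.mem_cons, List.not_mem_nil, or_false, not_or, List.nodup_nil, not_false_eq_true, and_true]
    clear * - nd n0 n1
    grind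
  all_goals (clear * -; ext t; simp only [Finset.mem_insert, Finset.mem_singleton]; tauto)
end
end HG
namespace HG
variable {V : Type*} [DecidableEq V] [Fintype V]

section

theorem Cfg.L2 {E : Finset (Finset V)} (h3 : ∀ e ∈ E, e.card = 3) {h : ℕ → Finset V} {a b c d e : V}
    (C : Cfg E h 2 a b c d e)
    (hcyc : ¬ HasLinearCycle E) (hd : ∀ w, Fintype.card V ≤ hDegree E w + 1)
    {p : Finset V} (hp : p ∈ L E a b) : p ⊆ h 1 := by
  rcases C.Lform' h3 hcyc hd hp with rfl | rfl | ⟨hc, i, hi, hik, rfl⟩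
  · rw [C.h1]; intro x; simp; tauto
  · rw [C.h1]; intro x; simp; tauto
  · obtain rfl : i = 1 := by omega
    exact Finset.sdiff_subset

theorem Cfg.W0 {E : Finset (Finset V)} (h3 : ∀ e ∈ E, e.card = 3) {h : ℕ → Finset V} {a b c d e : V}
    (C : Cfg E h 2 a b c d e)
    (hcyc : ¬ HasLinearCycle E) (hd : ∀ w, Fintype.card V ≤ hDegree E w + 1) (hn : 6 ≤ Fintype.card V)
    (hL : 2 ≤ (L E a b).card) {r : V} (hr : r ∉ VS h 2) : ({a,b,r} : Finset V) ∉ E := by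
  intro hE
  have nd := C.nd h3
  have c1 := A_card nd.1 (E := E)
  have c2 := deg_le h3 nd.1.symm
  rw [A_comm] at c2
  have c3 := hd b
  obtain ⟨q, hq⟩ := Finset.card_pos.1 (show 0 < (L E b a).card by omega)
  obtain ⟨p, hp, hpq⟩ := Finset.exists_mem_ne (show 1 < (L E a b).card by omega) q
  exact XT h3 hcyc (s := h 1) (h3 _ (C.lp.mem 1 (by omega))).le (C.a_not h3 le_rfl (by omega)) (C.b_not h3 le_rfl (by omega)) (fun hh => hr (mem_VS.2 ⟨1, by omega, hh⟩)) (C.L2 h3 hcyc hd hp) (C.swap.L2 h3 hcyc hd hq) hpq hp hq hE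

theorem Cfg.W1 {E : Finset (Finset V)} (h3 : ∀ e ∈ E, e.card = 3) {h : ℕ → Finset V} {a b c d e : V}
    (C : Cfg E h 2 a b c d e)
    (hcyc : ¬ HasLinearCycle E) (hd : ∀ w, Fintype.card V ≤ hDegree E w + 1) (hn : 6 ≤ Fintype.card V)
    (hng : ∀ a b : V, a ≠ b → ¬ ((L E a b).card ≤ 1 ∧ (L E b a).card ≤ 1)) {r : V} (hr : r ∉ VS h 2) : ({a,b,r} : Finset V) ∉ E := by
  have nd := C.nd h3
  by_cases h1 : (L E a b).card ≤ 1
  · have h2 : 2 ≤ (L E b a).card := by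
      by_contra hh; exact hng a b nd.1 ⟨h1, by omega⟩
    have := C.swap.W0 h3 hcyc hd hn h2 hr
    rwa [Finset.insert_comm] at this
  · exact C.W0 h3 hcyc hd hn (by omega) hr

theorem Cfg.W2 {E : Finset (Finset V)} (h3 : ∀ e ∈ E, e.card = 3) {h : ℕ → Finset V} {a b c d e : V}
    (C : Cfg E h 2 a b c d e)
    (hcyc : ¬ HasLinearCycle E) (hd : ∀ w, Fintype.card V ≤ hDegree E w + 1) (hn : 6 ≤ Fintype.card V)
    (hng : ∀ a b : V, a ≠ b → ¬ ((L E a b).card ≤ 1 ∧ (L E b a).card ≤ 1)) {r : V} (hr : r ∉ VS h 2)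
    {f : Finset V} (hf : f ∈ E) (hrf : r ∈ f) : a ∉ f := by
  intro haf
  have nd := C.nd h3
  have hra : r ≠ a := by rintro rfl; exact hr (C.mem_abc h3 (by tauto))
  have hrb : r ≠ b := by rintro rfl; exact hr (C.mem_abc h3 (by tauto))
  by_cases hb : b ∈ f
  · exact C.W1 h3 hcyc hd hn hng hr (meq hf (edge_eq h3 hf haf hb hrf nd.1 hra.symm hrb.symm))
  · have := C.L2 h3 hcyc hd (mem_L_erase h3 hf haf hb) (Finset.mem_erase.2 ⟨hra, hrf⟩)
    exact hr (mem_VS.2 ⟨1, by omega, this⟩)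

theorem Cfg.fin2 {E : Finset (Finset V)} (h3 : ∀ e ∈ E, e.card = 3) {h : ℕ → Finset V} {a b c d e : V}
    (C : Cfg E h 2 a b c d e)
    (hcyc : ¬ HasLinearCycle E) (hd : ∀ w, Fintype.card V ≤ hDegree E w + 1) (hn : 6 ≤ Fintype.card V)
    (hng : ∀ a b : V, a ≠ b → ¬ ((L E a b).card ≤ 1 ∧ (L E b a).card ≤ 1)) : False := by
  have nd := C.nd h3
  have C' : Cfg E (fun i => h (2 - 1 - i)) 2 d e c a b := by
    refine ⟨C.lp.rev, C.mx, le_rfl, ?_, ?_, by omega⟩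
    · show h 1 = _
      rw [C.h1]; clear * -; ext; simp; tauto
    · show h 0 = _
      rw [C.h0]; clear * -; ext; simp; tauto
  have hVS : ∀ r, r ∉ VS h 2 → r ∉ VS (fun i => h (2 - 1 - i)) 2 := by
    intro r hr hr'
    obtain ⟨i, hi, hri⟩ := mem_VS.1 hr'
    exact hr (mem_VS.2 ⟨2 - 1 - i, by omega, hri⟩)
  have hVc := C.VScard h3
  obtain ⟨r, hr⟩ := exists_notin (VS h 2) (by omega)
  have hA : A E a b ⊆ h 1 := by
    intro y hy
    rw [mem_A] at hy
    by_contra hcon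
    refine C.W1 h3 hcyc hd hn hng (r := y) ?_ hy.2.2
    intro hyV
    obtain ⟨i, hi, hyi⟩ := mem_VS.1 hyV
    have : i ≠ 1 := by rintro rfl; exact hcon hyi
    obtain rfl : i = 0 := by omega
    rw [C.h0] at hyi
    simp only [Finset.mem_insert, Finset.mem_singleton] at hyi
    rcases hyi with hm | hm | hm
    · exact hy.1 hm
    · exact hy.2.1 hm
    · apply hcon; rw [hm, C.h1]; simp
  have hL : L E a b ⊆ (h 1).powersetCard 2 := by
    intro p hp
    rw [Finset.mem_powersetCard]
    exact ⟨C.L2 h3 hcyc hd hp, (mem_L.1 hp).1⟩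
  have c3 : (h 1).card = 3 := h3 _ (C.lp.mem 1 (by omega))
  have c5 : ((h 1).powersetCard 2).card = 3 := by rw [Finset.card_powersetCard, c3]; rfl
  have c6 := deg_le h3 nd.1
  have c7 := hd a
  have c8 := Finset.card_le_card hA
  have c9 := Finset.card_le_card hL
  have c10 : ({a,b,d,e} : Finset V).card = 4 := by
    rw [Finset.card_insert_of_notMem, Finset.card_insert_of_notMem, Finset.card_pair nd.2.2.2.2.2.2.2.2.2]
    · simp; tauto
    · simp; tauto
  have c11 : (Finset.univ \ {a,b,d,e} : Finset V).card ≤ 3 := by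
    rw [Finset.card_sdiff_of_subset (Finset.subset_univ _), Finset.card_univ]
    omega
  have key : ∀ f ∈ E, r ∈ f → f = Finset.univ \ {a,b,d,e} := by
    intro f hf hrf
    apply Finset.eq_of_subset_of_card_le
    · have q1 := C.W2 h3 hcyc hd hn hng hr hf hrf
      have q2 := C.swap.W2 h3 hcyc hd hn hng hr hf hrf
      have q3 := C'.W2 h3 hcyc hd hn hng (hVS r hr) hf hrf
      have q4 := C'.swap.W2 h3 hcyc hd hn hng (hVS r hr) hf hrf
      intro x hx
      simp only [Finset.mem_sdiff, Finset.mem_univ, true_and, Finset.mem_insert, Finset.mem_singleton, not_or]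
      exact ⟨fun hh => q1 (hh ▸ hx), fun hh => q2 (hh ▸ hx), fun hh => q3 (hh ▸ hx), fun hh => q4 (hh ▸ hx)⟩
    · rw [h3 f hf]; exact c11
  have : hDegree E r ≤ 1 := by
    rw [hDegree, Finset.card_le_one]
    intro f hf g hg
    rw [Finset.mem_filter] at hf hg
    rw [key f hf.1 hf.2, key g hg.1 hg.2]
  have := hd r
  omega
end

theorem exists_meet {E : Finset (Finset V)} (h3 : ∀ e ∈ E, e.card = 3)
    (hd : ∀ w, Fintype.card V ≤ hDegree E w + 1) (hn : 6 ≤ Fintype.card V) :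
    ∃ e ∈ E, ∃ f ∈ E, (e ∩ f).card = 1 := by
  by_contra hcon
  push Not at hcon
  have hno : ∀ e ∈ E, ∀ f ∈ E, ∀ x, x ∈ e → x ∈ f → ∃ y, y ≠ x ∧ y ∈ e ∧ y ∈ f := by
    intro e he f hf x hx hx'
    by_contra hh
    push Not at hh
    apply hcon e he f hf
    rw [Finset.card_eq_one]
    refine ⟨x, ?_⟩
    ext y
    rw [Finset.mem_inter, Finset.mem_singleton]
    constructor
    · rintro ⟨h1, h2⟩
      by_contra hne
      exact hh y hne h1 h2
    · rintro rfl; exact ⟨hx, hx'⟩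
  obtain ⟨a0, -⟩ := exists_notin (∅ : Finset V) (by simp; omega)
  have h0 := hd a0
  rw [hDegree] at h0
  obtain ⟨g, hg⟩ := Finset.card_pos.1 (show 0 < (E.filter (fun e => a0 ∈ e)).card by omega)
  rw [Finset.mem_filter] at hg
  obtain ⟨a, b, c, hab, hac, hbc, rfl⟩ := Finset.card_eq_three.1 (h3 g hg.1)
  have hg := hg.1
  have hAL : ∀ y ∈ A E a b, ∀ p ∈ L E a b, y ∈ p := by
    intro y hy p hp
    rw [mem_A] at hy
    rw [mem_L] at hp
    obtain ⟨z, z1, z2, z3⟩ := hno _ hy.2.2 _ hp.2.2.2 a (by simp) (by simp)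
    simp only [Finset.mem_insert, Finset.mem_singleton] at z2 z3
    rcases z2 with rfl | rfl | rfl
    · exact absurd rfl z1
    · exact absurd (z3.resolve_left z1) hp.2.2.1
    · exact z3.resolve_left z1
  have hcA : c ∈ A E a b := mem_A.2 ⟨hac.symm, hbc.symm, hg⟩
  have c1 := deg_le h3 hab
  have c2 := hd a
  have c3 := A_card hab (E := E)
  have hL1 : (L E a b).card ≤ Fintype.card V - 3 := by
    have : L E a b ⊆ (Finset.univ \ {a,b,c}).image (fun z => ({c,z} : Finset V)) := by
      intro p hp
      have hcp := hAL c hcA p hp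
      rw [mem_L] at hp
      have : (p.erase c).card = 1 := by rw [Finset.card_erase_of_mem hcp, hp.1]
      obtain ⟨z, hz⟩ := Finset.card_eq_one.1 this
      have hz' : z ∈ p.erase c := by rw [hz]; simp
      rw [Finset.mem_erase] at hz'
      rw [Finset.mem_image]
      refine ⟨z, ?_, ?_⟩
      · simp only [Finset.mem_sdiff, Finset.mem_univ, true_and, Finset.mem_insert, Finset.mem_singleton, not_or]
        exact ⟨fun hh => hp.2.1 (hh ▸ hz'.2), fun hh => hp.2.2.1 (hh ▸ hz'.2), hz'.1⟩
      · rw [← Finset.insert_erase hcp, hz]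
    refine (Finset.card_le_card this).trans (Finset.card_image_le.trans ?_)
    rw [Finset.card_sdiff_of_subset (Finset.subset_univ _), Finset.card_univ, h3 _ hg]
  have hpos : 0 < (L E a b).card := by omega
  obtain ⟨p, hp⟩ := Finset.card_pos.1 hpos
  have hAp : ∀ q ∈ L E a b, A E a b ⊆ q := fun q hq y hy => hAL y hy q hq
  have c4 := Finset.card_le_card (hAp p hp)
  rw [(mem_L.1 hp).1] at c4
  have hL2 : (L E a b).card ≤ 1 := by
    rw [Finset.card_le_one]
    have : ∀ q ∈ L E a b, A E a b = q := fun q hq =>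
      Finset.eq_of_subset_of_card_le (hAp q hq) (by rw [(mem_L.1 hq).1]; omega)
    intro q hq q' hq'
    rw [← this q hq, ← this q' hq']
  omega

theorem exists_good {E : Finset (Finset V)} (h3 : ∀ e ∈ E, e.card = 3) (hcyc : ¬ HasLinearCycle E)
    (hd : ∀ w, Fintype.card V ≤ hDegree E w + 1) (hn : 6 ≤ Fintype.card V) :
    ∃ a b : V, a ≠ b ∧ (L E a b).card ≤ 1 ∧ (L E b a).card ≤ 1 := by
  classical
  by_contra hcon
  have hng : ∀ a b : V, a ≠ b → ¬ ((L E a b).card ≤ 1 ∧ (L E b a).card ≤ 1) :=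
    fun a b hab hh => hcon ⟨a, b, hab, hh⟩
  obtain ⟨f, hf, g, hg, hfg⟩ := exists_meet h3 hd hn
  have P2 : LP E (cons f (fun _ => g)) 2 := by
    have P1 : LP E (fun _ => g) 1 := ⟨fun _ _ => hg, by intro i hi; omega, by intro i j hi hj; omega⟩
    exact P1.cons hf (fun _ => hfg) (by intro i hi hi'; omega)
  have hbd : ∀ h k, LP E h k → k ≤ Fintype.card V := by
    intro h k H
    rcases k with _ | k
    · omega
    · have := VS_card h3 H
      have := Finset.card_le_univ (VS h (k+1))
      omega
  let P : ℕ → Prop := fun k => ∃ h, LP E h k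
  have hP2 : P 2 := ⟨_, P2⟩
  obtain ⟨h, H⟩ : P (Nat.findGreatest P (Fintype.card V)) := Nat.findGreatest_spec (hbd _ _ P2) hP2
  have k2 : 2 ≤ Nat.findGreatest P (Fintype.card V) := Nat.le_findGreatest (hbd _ _ P2) hP2
  have mx : ∀ h' k', LP E h' k' → k' ≤ Nat.findGreatest P (Fintype.card V) :=
    fun h' k' H' => Nat.le_findGreatest (hbd _ _ H') ⟨h', H'⟩
  generalize Nat.findGreatest P (Fintype.card V) = k at *
  obtain ⟨a, b, c, d, e, C⟩ := Cfg.exists h3 H mx k2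
  by_cases hk : k = 2
  · subst hk
    exact C.fin2 h3 hcyc hd hn hng
  · exact C.fin3 h3 hcyc hd (by omega) hng

theorem main {E : Finset (Finset V)} (h3 : ∀ e ∈ E, e.card = 3) (hcyc : ¬ HasLinearCycle E)
    (hd : ∀ w, Fintype.card V ≤ hDegree E w + 1) (hn : 6 ≤ Fintype.card V) :
    ∃ S : Finset V, S.card = Fintype.card V - 4 ∧ ∀ w ∈ S, hDegree E w ≤ hDegree (E.filter (fun e => e ⊆ S)) w + 2 := by
  obtain ⟨a, b, hab, h1, h2⟩ := exists_good h3 hcyc hd hn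
  obtain ⟨K, hK, hw⟩ := good_pair h3 hcyc hn hd hab h1 h2
  refine ⟨Finset.univ \ K, ?_, ?_⟩
  · rw [Finset.card_sdiff_of_subset (Finset.subset_univ _), Finset.card_univ, hK]
  · intro w hwS
    obtain ⟨e1, e2, he⟩ := hw w (Finset.mem_sdiff.1 hwS).2
    have : E.filter (fun e => w ∈ e) ⊆ ((E.filter (fun e => e ⊆ Finset.univ \ K)).filter (fun e => w ∈ e)) ∪ {e1, e2} := by
      intro f hf
      rw [Finset.mem_filter] at hf
      simp only [Finset.mem_union, Finset.mem_filter, Finset.mem_insert, Finset.mem_singleton]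
      by_cases hx : ∃ x ∈ f, x ∈ K
      · right; exact he f hf.1 hf.2 hx
      · left
        push Not at hx
        exact ⟨⟨hf.1, fun x hxf => Finset.mem_sdiff.2 ⟨Finset.mem_univ _, hx x hxf⟩⟩, hf.2⟩
    have h4 := card_union2 this
    have h5 : ({e1, e2} : Finset (Finset V)).card ≤ 2 := Finset.card_le_two
    unfold hDegree
    omega
end HG

theorem induced_subhypergraph_degree {V : Type*} [Fintype V] [DecidableEq V]
    (E : Finset (Finset V)) (h3 : ∀ e ∈ E, e.card = 3) (hcyc : ¬ HasLinearCycle E)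
    (s : ℤ) (hs : -1 ≤ s) (hn : 6 ≤ Fintype.card V)
    (hdeg : ∀ w : V, (Fintype.card V : ℤ) + s ≤ (hDegree E w : ℤ)) :
    ∃ S : Finset V, S.card = Fintype.card V - 4 ∧
      ∀ w ∈ S, (S.card : ℤ) + s + 2 ≤ ((hDegree (E.filter (fun e => e ⊆ S)) w : ℤ)) := by
  obtain ⟨S, hS, hw⟩ := HG.main h3 hcyc (fun w => by have := hdeg w; omega) hn
  refine ⟨S, hS, fun w hwS => ?_⟩
  have h1 := hw w hwS
  have h2 := hdeg w
  omega
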